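/- Let r ≥ 1, n ≥ 2, let V = ℂ^{r+1} be the vector representation of sl_{r+1}(ℂ), and let S_n act on V^{⊗n} ⊗ R_n diagonally, permuting the tensor factors of V^{⊗n} and acting on R_n as above (this action commutes with the sl_{r+1}-action on the V^{⊗n} factor). Then the space of S_n-invariants (V^{⊗n} ⊗ R_n)^{S_n} is isomorphic as an sl_{r+1}(ℂ)-module to V^{⊗n} ⊕ (n−1)·(V^{⊗(n−2)} ⊗ ∧²V). -/

import Mathlib

open MvPolynomial

set_option maxHeartbeats 1000000
set_option synthInstance.maxHeartbeats 400000

noncomputable section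

/-- the ideal `(x₁y₁, …, xₙyₙ)`. -/
abbrev Bideal (n : ℕ) : Ideal (MvPolynomial (Fin n ⊕ Fin n) ℂ) :=
  Ideal.span (Set.range fun i : Fin n => X (Sum.inl i) * X (Sum.inr i))

/-- `B n = ℂ[x₁,…,xₙ,y₁,…,yₙ]/(x₁y₁,…,xₙyₙ)`, the `n`-th tensor power of `ℂ[x,y]/(xy)`.
The variable `x_i` is `X (Sum.inl i)` and `y_i` is `X (Sum.inr i)`. -/
abbrev B (n : ℕ) : Type := MvPolynomial (Fin n ⊕ Fin n) ℂ ⧸ Bideal n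

abbrev mkB (n : ℕ) : MvPolynomial (Fin n ⊕ Fin n) ℂ →ₐ[ℂ] B n :=
  Ideal.Quotient.mkₐ ℂ (Bideal n)

def xv (n : ℕ) (i : Fin n) : B n := mkB n (X (Sum.inl i))
def yv (n : ℕ) (i : Fin n) : B n := mkB n (X (Sum.inr i))

/-- the action of a permutation `σ ∈ Sₙ` on `B n`: `σ·xᵢ = x_{σ i}`, `σ·yᵢ = y_{σ i}`. -/
def permB (n : ℕ) (σ : Equiv.Perm (Fin n)) : B n →ₐ[ℂ] B n :=
  Ideal.Quotient.liftₐ (Bideal n)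
    ((mkB n).comp (MvPolynomial.rename (Sum.map ⇑σ ⇑σ)))
    (by
      intro a ha
      have h : Bideal n ≤ RingHom.ker ((mkB n).comp (MvPolynomial.rename (Sum.map ⇑σ ⇑σ))).toRingHom := by
        rw [Ideal.span_le]
        rintro _ ⟨i, rfl⟩
        simp only [SetLike.mem_coe, RingHom.mem_ker, AlgHom.toRingHom_eq_coe, RingHom.coe_coe,
          AlgHom.comp_apply, map_mul, rename_X, Sum.map_inl, Sum.map_inr]
        rw [← map_mul, Ideal.Quotient.mkₐ_eq_mk, Ideal.Quotient.eq_zero_iff_mem]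
        exact Ideal.subset_span ⟨σ i, rfl⟩
      exact h ha)

/-- evaluation at the origin. -/
def ev0 (n : ℕ) : B n →ₐ[ℂ] ℂ :=
  Ideal.Quotient.liftₐ (Bideal n) (aeval fun _ => (0 : ℂ))
    (by
      intro a ha
      have h : Bideal n ≤ RingHom.ker (aeval (R := ℂ) fun _ : Fin n ⊕ Fin n => (0 : ℂ)).toRingHom := by
        rw [Ideal.span_le]
        rintro _ ⟨i, rfl⟩
        simp [RingHom.mem_ker]
      exact h ha)

/-- `Jₙ`, the ideal of `B n` generated by the `Sₙ`-invariant elements vanishing at the origin. -/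
def Jn (n : ℕ) : Ideal (B n) :=
  Ideal.span {p : B n | (∀ σ : Equiv.Perm (Fin n), permB n σ p = p) ∧ ev0 n p = 0}

/-- the symmetric coinvariant algebra `Rₙ = Bₙ/Jₙ`. -/
abbrev Rn (n : ℕ) : Type := B n ⧸ Jn n

/-- the action of `σ ∈ Sₙ` on the symmetric coinvariant algebra `Rₙ`. -/
def permR (n : ℕ) (σ : Equiv.Perm (Fin n)) : Rn n →ₐ[ℂ] Rn n :=
  Ideal.Quotient.liftₐ (Jn n) ((Ideal.Quotient.mkₐ ℂ (Jn n)).comp (permB n σ))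
    (by
      intro a ha
      have h : Jn n ≤ RingHom.ker ((Ideal.Quotient.mkₐ ℂ (Jn n)).comp (permB n σ)).toRingHom := by
        rw [Jn, Ideal.span_le]
        rintro p ⟨hinv, hev⟩
        simp only [SetLike.mem_coe, RingHom.mem_ker, AlgHom.toRingHom_eq_coe, RingHom.coe_coe,
          AlgHom.comp_apply, hinv σ, Ideal.Quotient.mkₐ_eq_mk, Ideal.Quotient.eq_zero_iff_mem]
        exact Ideal.subset_span ⟨hinv, hev⟩
      exact h ha)

/-- the action of a matrix `X ∈ sl_{r+1}` on `V^{⊗n} ⊗ M`, where `V = ℂ^{r+1}` and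
`V^{⊗n} ⊗ M` is realized as `M`-valued functions on the index set of the standard
basis of `V^{⊗n}` (so `X` acts by the Leibniz rule on the `n` tensor factors). -/
def slAct (r n : ℕ) (M : Type) [AddCommGroup M] [Module ℂ M]
    (X : Matrix (Fin (r + 1)) (Fin (r + 1)) ℂ) :
    ((Fin n → Fin (r + 1)) → M) →ₗ[ℂ] ((Fin n → Fin (r + 1)) → M) where
  toFun F := fun φ => ∑ k : Fin n, ∑ j : Fin (r + 1), X (φ k) j • F (Function.update φ k j)
  map_add' F G := by
    funext φ
    simp only [Pi.add_apply, smul_add]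
    rw [← Finset.sum_add_distrib]
    refine Finset.sum_congr rfl fun k _ => ?_
    rw [← Finset.sum_add_distrib]
  map_smul' c F := by
    funext φ
    simp only [Pi.smul_apply, RingHom.id_apply, Finset.smul_sum]
    refine Finset.sum_congr rfl fun k _ => ?_
    refine Finset.sum_congr rfl fun j _ => ?_
    rw [smul_comm]

/-- `(V^{⊗n} ⊗ Rₙ)^{Sₙ}`: the submodule of `Sₙ`-invariants of `V^{⊗n} ⊗ Rₙ`, where `Sₙ`
acts diagonally, permuting the tensor factors of `V^{⊗n}` and acting on `Rₙ` via `permR`. -/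
def InvSub (r n : ℕ) : Submodule ℂ ((Fin n → Fin (r + 1)) → Rn n) where
  carrier := {F | ∀ (σ : Equiv.Perm (Fin n)) (φ : Fin n → Fin (r + 1)),
    permR n σ (F (φ ∘ ⇑σ)) = F φ}
  zero_mem' := by intro σ φ; simp
  add_mem' := by
    intro F G hF hG σ φ
    simp only [Pi.add_apply, map_add, hF σ φ, hG σ φ]
  smul_mem' := by
    intro c F hF σ φ
    simp only [Pi.smul_apply, map_smul, hF σ φ]

/-- the transposition of the last two letters. -/
def swapLast (n : ℕ) : Equiv.Perm (Fin n) :=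
  if h : 2 ≤ n then Equiv.swap ⟨n - 2, by omega⟩ ⟨n - 1, by omega⟩ else 1

/-- `V^{⊗(n-2)} ⊗ ∧²V`, realized as the subspace of `V^{⊗n}` of tensors antisymmetric
in the last two tensor factors. -/
def AltLast (r n : ℕ) : Submodule ℂ ((Fin n → Fin (r + 1)) → ℂ) where
  carrier := {F | ∀ φ, F (φ ∘ ⇑(swapLast n)) = - F φ}
  zero_mem' := by intro φ; simp
  add_mem' := by
    intro F G hF hG φ
    simp only [Pi.add_apply, hF φ, hG φ]
    ring
  smul_mem' := by
    intro c F hF φ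
    simp only [Pi.smul_apply, hF φ, smul_eq_mul]
    ring

section Cancellation

variable {A : Type*} [Ring A] [IsSemisimpleRing A]

/-- Every epimorphism of modules over a semisimple ring splits. -/
lemma nonempty_equiv_ker_prod {M N : Type*} [AddCommGroup M] [Module A M]
    [AddCommGroup N] [Module A N] (f : M →ₗ[A] N) (hf : Function.Surjective f) :
    Nonempty (M ≃ₗ[A] LinearMap.ker f × N) := by
  obtain ⟨q, hq⟩ := exists_isCompl (LinearMap.ker f)
  exact ⟨(Submodule.prodEquivOfIsCompl _ q hq).symm ≪≫ₗ
    (LinearEquiv.refl A _).prodCongr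
      ((Submodule.quotientEquivOfIsCompl _ q hq).symm ≪≫ₗ f.quotKerEquivOfSurjective hf)⟩

/-- The kernel of a map restricted to a submodule is the intersection with the kernel. -/
def kerDomRestrictEquiv {M N : Type*} [AddCommGroup M] [Module A M]
    [AddCommGroup N] [Module A N] (f : M →ₗ[A] N) (p : Submodule A M) :
    LinearMap.ker (f.domRestrict p) ≃ₗ[A] (p ⊓ LinearMap.ker f : Submodule A M) where
  toFun x := ⟨x.1.1, x.1.2, x.2⟩
  invFun x := ⟨⟨x.1, x.2.1⟩, x.2.2⟩
  map_add' _ _ := rfl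
  map_smul' _ _ := rfl
  left_inv _ := rfl
  right_inv _ := rfl

lemma ker_equiv_inf_prod_of_not_le {M S : Type*} [AddCommGroup M] [Module A M]
    [AddCommGroup S] [Module A S] [IsSimpleModule A S] (f g : M →ₗ[A] S)
    (h : ¬ LinearMap.ker f ≤ LinearMap.ker g) :
    Nonempty (LinearMap.ker f ≃ₗ[A]
      (LinearMap.ker f ⊓ LinearMap.ker g : Submodule A M) × S) := by
  have hs : Function.Surjective (g.domRestrict (LinearMap.ker f)) := by
    refine LinearMap.surjective_of_ne_zero fun h0 => h fun x hx => ?_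
    exact LinearMap.congr_fun h0 ⟨x, hx⟩
  obtain ⟨e⟩ := nonempty_equiv_ker_prod _ hs
  exact ⟨e ≪≫ₗ (kerDomRestrictEquiv g _).prodCongr (LinearEquiv.refl A S)⟩

lemma nonempty_equiv_ker_of_simple {M S : Type*} [AddCommGroup M] [Module A M]
    [AddCommGroup S] [Module A S] [IsSimpleModule A S] (f g : M →ₗ[A] S)
    (hf : Function.Surjective f) (hg : Function.Surjective g) :
    Nonempty (LinearMap.ker f ≃ₗ[A] LinearMap.ker g) := by
  have key : ∀ f g : M →ₗ[A] S, Function.Surjective f → Function.Surjective g →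
      LinearMap.ker f ≤ LinearMap.ker g → LinearMap.ker f = LinearMap.ker g := by
    intro f g hf hg hle
    have h1 : IsCoatom (LinearMap.ker f) := by
      rw [← isSimpleModule_iff_isCoatom]
      exact IsSimpleModule.congr (f.quotKerEquivOfSurjective hf)
    rcases h1.le_iff.mp hle with h | h
    · exfalso
      have := IsSimpleModule.nontrivial A S
      obtain ⟨s, hs⟩ := exists_ne (0 : S)
      obtain ⟨x, rfl⟩ := hg s
      exact hs (LinearMap.congr_fun (LinearMap.ker_eq_top.mp h) x)
    · exact h.symm
  by_cases h1 : LinearMap.ker f ≤ LinearMap.ker g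
  · exact ⟨LinearEquiv.ofEq _ _ (key f g hf hg h1)⟩
  by_cases h2 : LinearMap.ker g ≤ LinearMap.ker f
  · exact ⟨LinearEquiv.ofEq _ _ (key g f hg hf h2).symm⟩
  obtain ⟨e1⟩ := ker_equiv_inf_prod_of_not_le f g h1
  obtain ⟨e2⟩ := ker_equiv_inf_prod_of_not_le g f h2
  exact ⟨e1 ≪≫ₗ (LinearEquiv.ofEq _ _ (inf_comm _ _)).prodCongr (LinearEquiv.refl A S) ≪≫ₗ
    e2.symm⟩

/-- The kernel of the second projection of a product. -/
def kerSndEquiv (M S : Type*) [AddCommGroup M] [Module A M] [AddCommGroup S] [Module A S] :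
    LinearMap.ker (LinearMap.snd A M S) ≃ₗ[A] M where
  toFun x := x.1.1
  invFun x := ⟨(x, 0), rfl⟩
  map_add' _ _ := rfl
  map_smul' _ _ := rfl
  left_inv x := by
    rcases x with ⟨⟨a, b⟩, h⟩
    have : b = 0 := h
    subst this
    rfl
  right_inv _ := rfl

/-- The kernel of a composite with an equivalence. -/
def kerCompEquiv {M M' N : Type*} [AddCommGroup M] [Module A M] [AddCommGroup M'] [Module A M']
    [AddCommGroup N] [Module A N] (f : M' →ₗ[A] N) (e : M ≃ₗ[A] M') :
    LinearMap.ker (f ∘ₗ e.toLinearMap) ≃ₗ[A] LinearMap.ker f where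
  toFun x := ⟨e x.1, x.2⟩
  invFun x := ⟨e.symm x.1, by simp⟩
  map_add' _ _ := by ext; simp
  map_smul' _ _ := by ext; simp
  left_inv _ := by ext; simp
  right_inv _ := by ext; simp

lemma cancel_simple {M M' S : Type*} [AddCommGroup M] [Module A M] [AddCommGroup M'] [Module A M']
    [AddCommGroup S] [Module A S] [IsSimpleModule A S] (e : (M × S) ≃ₗ[A] (M' × S)) :
    Nonempty (M ≃ₗ[A] M') := by
  obtain ⟨e'⟩ := nonempty_equiv_ker_of_simple (LinearMap.snd A M S)
    (LinearMap.snd A M' S ∘ₗ e.toLinearMap) (LinearMap.snd_surjective (R := A))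
    ((LinearMap.snd_surjective (R := A)).comp e.surjective)
  exact ⟨(kerSndEquiv M S).symm ≪≫ₗ e' ≪≫ₗ kerCompEquiv _ e ≪≫ₗ kerSndEquiv M' S⟩

/-- Cancellation of an artinian direct summand over a semisimple ring. -/
lemma cancel_prod {M M' N : Type*} [AddCommGroup M] [Module A M] [AddCommGroup M'] [Module A M']
    [AddCommGroup N] [Module A N] [IsArtinian A N] (e : (M × N) ≃ₗ[A] (M' × N)) :
    Nonempty (M ≃ₗ[A] M') := by
  have key : ∀ W : Submodule A N, Nonempty ((M × W) ≃ₗ[A] (M' × W)) → Nonempty (M ≃ₗ[A] M') := by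
    intro W
    induction W using WellFoundedLT.induction with
    | ind W ih =>
      rintro ⟨e⟩
      rcases IsSemisimpleModule.eq_bot_or_exists_simple_le W with rfl | ⟨S, hSW, hS⟩
      · exact ⟨(LinearEquiv.prodUnique (R := A) (M := M)
          (M₂ := (⊥ : Submodule A N))).symm ≪≫ₗ e ≪≫ₗ LinearEquiv.prodUnique⟩
      · obtain ⟨C, hC⟩ := exists_isCompl (Submodule.comap W.subtype S)
        let C' := C.map W.subtype
        have eS : Submodule.comap W.subtype S ≃ₗ[A] S :=
          Submodule.comapSubtypeEquivOfLe hSW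
        have eC : C ≃ₗ[A] C' := Submodule.equivMapOfInjective _ W.injective_subtype C
        have eW : W ≃ₗ[A] C' × S := (Submodule.prodEquivOfIsCompl _ _ hC).symm ≪≫ₗ
          eS.prodCongr eC ≪≫ₗ LinearEquiv.prodComm A _ _
        have hlt : C' < W := by
          refine lt_of_le_of_ne (Submodule.map_subtype_le W C) fun h => ?_
          have hCt : C = ⊤ := by
            refine eq_top_iff.mpr fun x _ => ?_
            have hx : (x : N) ∈ C' := h.symm ▸ x.2
            obtain ⟨y, hy, hyx⟩ := hx
            have : y = x := Subtype.ext hyx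
            exact this ▸ hy
          have hbot : Submodule.comap W.subtype S = ⊥ := by
            have := hC.inf_eq_bot
            rwa [hCt, inf_top_eq] at this
          have := IsSimpleModule.nontrivial A S
          obtain ⟨s, hs⟩ := exists_ne (0 : S)
          apply hs
          have : (⟨s.1, hSW s.2⟩ : W) ∈ Submodule.comap W.subtype S := s.2
          rw [hbot, Submodule.mem_bot] at this
          exact Subtype.ext (congrArg (fun x : W => (x : N)) this)
        refine ih C' hlt ?_
        exact cancel_simple (S := S) (LinearEquiv.prodAssoc A _ _ _ ≪≫ₗ
          (LinearEquiv.refl A M).prodCongr eW.symm ≪≫ₗ e ≪≫ₗ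
          (LinearEquiv.refl A M').prodCongr eW ≪≫ₗ (LinearEquiv.prodAssoc A _ _ _).symm)
  exact key ⊤ ⟨(LinearEquiv.refl A M).prodCongr Submodule.topEquiv ≪≫ₗ e ≪≫ₗ
    (LinearEquiv.refl A M').prodCongr Submodule.topEquiv.symm⟩

/-- `P / (X ⊓ Y) ⊕ P / (X ⊔ Y) ≅ P / X ⊕ P / Y` over a semisimple ring. -/
lemma quotient_inf_prod_sup {P : Type*} [AddCommGroup P] [Module A P] (X Y : Submodule A P) :
    Nonempty (((P ⧸ (X ⊓ Y)) × (P ⧸ (X ⊔ Y))) ≃ₗ[A] ((P ⧸ X) × (P ⧸ Y))) := by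
  let d : ((P ⧸ X) × (P ⧸ Y)) →ₗ[A] (P ⧸ (X ⊔ Y)) :=
    (Submodule.factor le_sup_left).coprod (-(Submodule.factor le_sup_right))
  have hd : Function.Surjective d := by
    intro z
    obtain ⟨p, rfl⟩ := Submodule.mkQ_surjective _ z
    exact ⟨(X.mkQ p, 0), by simp [d]⟩
  let δ : P →ₗ[A] LinearMap.ker d :=
    (X.mkQ.prod Y.mkQ).codRestrict _ (by intro p; simp [d])
  have hδ : Function.Surjective δ := by
    rintro ⟨⟨a, b⟩, hab⟩
    obtain ⟨p, rfl⟩ := Submodule.mkQ_surjective _ a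
    obtain ⟨q, rfl⟩ := Submodule.mkQ_surjective _ b
    have h : p - q ∈ X ⊔ Y := by
      rw [← Submodule.Quotient.mk_eq_zero]
      simpa [d, sub_eq_add_neg] using hab
    obtain ⟨x, hx, y, hy, hxy⟩ := Submodule.mem_sup.mp h
    refine ⟨p - x, Subtype.ext (Prod.ext ?_ ?_)⟩
    · change X.mkQ (p - x) = X.mkQ p
      simpa using hx
    · change Y.mkQ (p - x) = Y.mkQ q
      have : p - x = q + y := by rw [sub_eq_iff_eq_add, add_assoc, add_comm y, hxy]; abel
      rw [this]
      simpa using hy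
  have hker : LinearMap.ker δ = X ⊓ Y := by
    ext p
    simp [δ]
  obtain ⟨e⟩ := nonempty_equiv_ker_prod d hd
  exact ⟨((Submodule.quotEquivOfEq _ _ hker.symm ≪≫ₗ δ.quotKerEquivOfSurjective hδ).prodCongr
    (LinearEquiv.refl A _)) ≪≫ₗ e.symm⟩

end Cancellation

section Straightening

variable {n : ℕ}

/-- The monomial in two families of variables attached to an integer vector: positive entries
are exponents of the first family, negative ones of the second. -/
def zmon {P : Type*} [CommRing P] (u v : Fin n → P) (a : Fin n → ℤ) : P :=
  ∏ i, (u i ^ (a i).toNat * v i ^ (-a i).toNat)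

lemma zmon_neg {P : Type*} [CommRing P] (u v : Fin n → P) (a : Fin n → ℤ) :
    zmon u v (-a) = zmon v u a := by
  simp only [zmon, Pi.neg_apply, neg_neg]
  exact Finset.prod_congr rfl fun i _ => mul_comm _ _

/-- The vector obtained by adding one to the entries in `T`. -/
def raise (a : Fin n → ℤ) (T : Finset (Fin n)) : Fin n → ℤ :=
  fun i => a i + if i ∈ T then 1 else 0

lemma prod_mul_zmon {P : Type*} [CommRing P] (u v : Fin n → P) (a : Fin n → ℤ)
    (T : Finset (Fin n)) (hT : ∀ i ∈ T, 0 ≤ a i) :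
    (∏ i ∈ T, u i) * zmon u v a = zmon u v (raise a T) := by
  have h : ∏ i ∈ T, u i = ∏ i, if i ∈ T then u i else 1 := by
    rw [Finset.prod_ite_mem, Finset.univ_inter]
  rw [h, zmon, zmon, ← Finset.prod_mul_distrib]
  refine Finset.prod_congr rfl fun i _ => ?_
  by_cases hi : i ∈ T
  · have h0 := hT i hi
    have e1 : (raise a T i).toNat = (a i).toNat + 1 := by simp [raise, hi]; omega
    have e2 : (-raise a T i).toNat = 0 := by simp [raise, hi]; omega
    have e3 : (-a i).toNat = 0 := by omega
    rw [e1, e2, e3, if_pos hi]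
    ring
  · simp [raise, hi]

lemma prod_mul_zmon_mem {P : Type*} [CommRing P] (u v : Fin n → P) (L : Ideal P)
    (huv : ∀ i, u i * v i ∈ L) (a : Fin n → ℤ)
    (T : Finset (Fin n)) (t : Fin n) (ht : t ∈ T) (hneg : a t < 0) :
    (∏ i ∈ T, u i) * zmon u v a ∈ L := by
  have h1 : u t ∣ ∏ i ∈ T, u i := Finset.dvd_prod_of_mem u ht
  have h2 : v t ∣ zmon u v a := by
    refine dvd_trans ?_ (Finset.dvd_prod_of_mem _ (Finset.mem_univ t))
    exact dvd_mul_of_dvd_right (dvd_pow_self _ (by omega)) _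
  exact L.mem_of_dvd (mul_dvd_mul h1 h2) (huv t)

/-- The quadratic weight controlling termination of the straightening. -/
def quadWeight (h : Fin n → ℤ) (a : Fin n → ℤ) : ℤ :=
  ∑ i, ((n : ℤ) * a i ^ 2 - 2 * h i * a i)

lemma quadWeight_raise (h a : Fin n → ℤ) (T : Finset (Fin n)) :
    quadWeight h (raise a T) = quadWeight h a + ∑ i ∈ T, (2 * ((n : ℤ) * a i - h i) + n) := by
  have e : ∑ i ∈ T, (2 * ((n : ℤ) * a i - h i) + n)
      = ∑ i, if i ∈ T then (2 * ((n : ℤ) * a i - h i) + n) else 0 := by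
    rw [Finset.sum_ite_mem, Finset.univ_inter]
  rw [e, quadWeight, quadWeight, ← Finset.sum_add_distrib]
  refine Finset.sum_congr rfl fun i _ => ?_
  by_cases hi : i ∈ T
  · simp only [raise, hi, if_true]; ring
  · simp [raise, hi]

lemma quadWeight_nonneg (h : Fin n → ℤ) (hh : ∀ i, |h i| ≤ n) (a : Fin n → ℤ) :
    0 ≤ quadWeight h a + (n : ℤ) * n := by
  have : (n : ℤ) * n = ∑ _i : Fin n, (n : ℤ) := by simp
  rw [this, quadWeight, ← Finset.sum_add_distrib]
  refine Finset.sum_nonneg fun i _ => ?_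
  have h1 := abs_le.mp (hh i)
  rcases le_total 0 (a i) with h0 | h0
  · nlinarith [mul_nonneg (sub_nonneg.mpr h1.2) h0, mul_nonneg (Nat.cast_nonneg n : (0:ℤ) ≤ n) (sq_nonneg (a i - 1))]
  · nlinarith [mul_nonneg (neg_le_iff_add_nonneg.mp h1.1) (neg_nonneg.mpr h0), mul_nonneg (Nat.cast_nonneg n : (0:ℤ) ≤ n) (sq_nonneg (a i + 1))]

lemma sum_lt_sum_of_separated {ι : Type*} [DecidableEq ι] (k : ι → ℤ) (U T : Finset ι)
    (hcard : T.card = U.card) (hne : T ≠ U) (hsep : ∀ i ∈ U, ∀ j ∉ U, k j < k i) :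
    ∑ i ∈ T, k i < ∑ i ∈ U, k i := by
  have h1 := Finset.sum_inter_add_sum_sdiff T U k
  have h2 := Finset.sum_inter_add_sum_sdiff U T k
  rw [Finset.inter_comm] at h2
  have hc : (T \ U).card = (U \ T).card := Finset.card_sdiff_comm hcard
  have hpos : (U \ T).Nonempty := by
    rw [Finset.nonempty_iff_ne_empty]
    intro h
    rw [Finset.sdiff_eq_empty_iff_subset] at h
    exact hne (Finset.eq_of_subset_of_card_le h hcard.le).symm
  have hpos' : (T \ U).Nonempty := by
    rw [← Finset.card_pos, hc, Finset.card_pos]; exact hpos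
  obtain ⟨i, hi, hmin⟩ := Finset.exists_min_image (U \ T) k hpos
  have h3 : (U \ T).card • k i ≤ ∑ j ∈ U \ T, k j := Finset.card_nsmul_le_sum _ _ _ hmin
  have h4 : ∑ j ∈ T \ U, k j < ∑ _j ∈ T \ U, k i :=
    Finset.sum_lt_sum_of_nonempty hpos' fun j hj =>
      hsep i (Finset.mem_sdiff.mp hi).1 j (Finset.mem_sdiff.mp hj).2
  rw [Finset.sum_const, hc] at h4
  linarith

/-- One straightening step. -/
lemma zmon_mem_of_separated {P : Type*} [CommRing P] [Algebra ℂ P] (u v : Fin n → P) (L : Ideal P)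
    (huv : ∀ i, u i * v i ∈ L)
    (he : ∀ k, 1 ≤ k → ∑ T ∈ Finset.powersetCard k Finset.univ, ∏ i ∈ T, u i ∈ L)
    (W : Submodule ℂ P) (hLW : ∀ f ∈ L, f ∈ W) (h a : Fin n → ℤ)
    (ih : ∀ b, quadWeight h b < quadWeight h a → zmon u v b ∈ W)
    (U : Finset (Fin n)) (hU : U.Nonempty) (hpos : ∀ i ∈ U, 1 ≤ a i)
    (hsep : ∀ i ∈ U, ∀ j ∉ U, (n : ℤ) * a j - h j < n * (a i - 1) - h i) :
    zmon u v a ∈ W := by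
  let a' : Fin n → ℤ := fun i => a i - if i ∈ U then 1 else 0
  have ha' : raise a' U = a := by
    funext i; simp [raise, a']
  have hU' : ∀ i ∈ U, 0 ≤ a' i := fun i hi => by
    have := hpos i hi
    simp only [a', hi, if_true]; omega
  have hmem : U ∈ Finset.powersetCard U.card (Finset.univ : Finset (Fin n)) := by
    simp [Finset.mem_powersetCard]
  have h1 := L.mul_mem_right (zmon u v a') (he U.card hU.card_pos)
  rw [Finset.sum_mul, ← Finset.add_sum_erase _ _ hmem, prod_mul_zmon u v a' U hU', ha'] at h1
  have h2 : ∑ T ∈ (Finset.powersetCard U.card Finset.univ).erase U,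
      (∏ i ∈ T, u i) * zmon u v a' ∈ W := by
    refine W.sum_mem fun T hT => ?_
    obtain ⟨hTU, hTc⟩ := Finset.mem_erase.mp hT
    have hTc := (Finset.mem_powersetCard.mp hTc).2
    by_cases hneg : ∃ t ∈ T, a' t < 0
    · obtain ⟨t, ht, hneg⟩ := hneg
      exact hLW _ (prod_mul_zmon_mem u v L huv a' T t ht hneg)
    · push Not at hneg
      rw [prod_mul_zmon u v a' T hneg]
      apply ih
      rw [← ha', quadWeight_raise, quadWeight_raise]
      have := sum_lt_sum_of_separated (fun i => 2 * ((n : ℤ) * a' i - h i) + n) U T hTc hTU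
        (by
          intro i hi j hj
          have := hsep i hi j hj
          simp only [a', hi, hj, if_true, if_false]
          linarith)
      linarith
  have := W.sub_mem (hLW _ h1) h2
  simpa using this

/-- Standard vectors: those to which no straightening step applies. -/
def IsStandard (a : Fin n → ℤ) : Prop :=
  (∀ U : Finset (Fin n), U.Nonempty → (∀ i ∈ U, 1 ≤ a i) →
    ¬ ∀ i ∈ U, ∀ j ∉ U, (n : ℤ) * a j - (j : ℕ) < n * (a i - 1) - (i : ℕ)) ∧
  (∀ U : Finset (Fin n), U.Nonempty → (∀ i ∈ U, a i ≤ -1) →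
    ¬ ∀ i ∈ U, ∀ j ∉ U, (n : ℤ) * (a i + 1) - (i : ℕ) < n * a j - (j : ℕ))

lemma zmon_mem_of_standard {P : Type*} [CommRing P] [Algebra ℂ P] (u v : Fin n → P) (L : Ideal P)
    (huv : ∀ i, u i * v i ∈ L)
    (heu : ∀ k, 1 ≤ k → ∑ T ∈ Finset.powersetCard k Finset.univ, ∏ i ∈ T, u i ∈ L)
    (hev : ∀ k, 1 ≤ k → ∑ T ∈ Finset.powersetCard k Finset.univ, ∏ i ∈ T, v i ∈ L)
    (W : Submodule ℂ P) (hLW : ∀ f ∈ L, f ∈ W)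
    (hW : ∀ a, IsStandard a → zmon u v a ∉ L → zmon u v a ∈ W) (a : Fin n → ℤ) :
    zmon u v a ∈ W := by
  let h : Fin n → ℤ := fun i => (i : ℕ)
  have hh : ∀ i, |h i| ≤ n := fun i => by
    simp only [h, Nat.abs_cast]; exact_mod_cast i.2.le
  obtain ⟨N, hN⟩ : ∃ N : ℕ, (quadWeight h a + (n : ℤ) * n).toNat = N := ⟨_, rfl⟩
  induction N using Nat.strong_induction_on generalizing a with
  | _ N ih =>
    have ih' : ∀ b, quadWeight h b < quadWeight h a → zmon u v b ∈ W := by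
      intro b hb
      refine ih _ ?_ b rfl
      have := quadWeight_nonneg h hh b
      omega
    by_cases hL : zmon u v a ∈ L
    · exact hLW _ hL
    by_cases hs : IsStandard a
    · exact hW a hs hL
    rw [IsStandard, not_and_or] at hs
    rcases hs with hs | hs
    · push Not at hs
      obtain ⟨U, hU, hpos, hsep⟩ := hs
      exact zmon_mem_of_separated u v L huv heu W hLW h a ih' U hU hpos hsep
    · push Not at hs
      obtain ⟨U, hU, hpos, hsep⟩ := hs
      have hq : ∀ b, quadWeight (-h) b = quadWeight h (-b) := by
        intro b
        simp only [quadWeight, Pi.neg_apply]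
        exact Finset.sum_congr rfl fun i _ => by ring
      rw [← zmon_neg]
      refine zmon_mem_of_separated v u L (fun i => mul_comm (u i) (v i) ▸ huv i) hev W hLW
        (-h) (-a) ?_ U hU ?_ ?_
      · intro b hb
        rw [hq, hq, neg_neg] at hb
        have := ih' _ hb
        rwa [zmon_neg] at this
      · intro i hi
        have := hpos i hi
        simp only [Pi.neg_apply]; omega
      · intro i hi j hj
        have := hsep i hi j hj
        simp only [Pi.neg_apply, h]
        linarith

lemma monomial_eq_zmon_or_mem (L : Ideal (MvPolynomial (Fin n ⊕ Fin n) ℂ))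
    (huv : ∀ i, X (Sum.inl i) * X (Sum.inr i) ∈ L) (m : (Fin n ⊕ Fin n) →₀ ℕ) :
    monomial m (1 : ℂ) ∈ L ∨
      ∃ a, monomial m (1 : ℂ) = zmon (fun i => X (Sum.inl i)) (fun i => X (Sum.inr i)) a := by
  have hm : monomial m (1 : ℂ)
      = ∏ i, (X (Sum.inl i) ^ m (Sum.inl i) * X (Sum.inr i) ^ m (Sum.inr i)) := by
    rw [monomial_eq, C_1, one_mul, Finsupp.prod_fintype _ _ (fun _ => pow_zero _),
      Fintype.prod_sum_type, Finset.prod_mul_distrib]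
  by_cases h : ∃ i, m (Sum.inl i) ≠ 0 ∧ m (Sum.inr i) ≠ 0
  · left
    obtain ⟨i, h1, h2⟩ := h
    rw [hm]
    refine L.mem_of_dvd ?_ (huv i)
    exact dvd_trans (mul_dvd_mul (dvd_pow_self _ h1) (dvd_pow_self _ h2))
      (Finset.dvd_prod_of_mem _ (Finset.mem_univ i))
  · right
    push Not at h
    refine ⟨fun i => (m (Sum.inl i) : ℤ) - m (Sum.inr i), ?_⟩
    rw [hm, zmon]
    refine Finset.prod_congr rfl fun i _ => ?_
    have := h i
    congr 2
    · rcases Nat.eq_zero_or_pos (m (Sum.inl i)) with h0 | h0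
      · omega
      · have := this h0.ne'; omega
    · rcases Nat.eq_zero_or_pos (m (Sum.inl i)) with h0 | h0
      · omega
      · have := this h0.ne'; omega

/-- The codimension of an ideal containing the basic invariants is at most the number of standard
monomials outside it. -/
lemma finrank_quotient_le_ncard (L : Ideal (MvPolynomial (Fin n ⊕ Fin n) ℂ))
    (huv : ∀ i, X (Sum.inl i) * X (Sum.inr i) ∈ L)
    (heu : ∀ k, 1 ≤ k → ∑ T ∈ Finset.powersetCard k Finset.univ,
      ∏ i ∈ T, (X (Sum.inl i) : MvPolynomial (Fin n ⊕ Fin n) ℂ) ∈ L)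
    (hev : ∀ k, 1 ≤ k → ∑ T ∈ Finset.powersetCard k Finset.univ,
      ∏ i ∈ T, (X (Sum.inr i) : MvPolynomial (Fin n ⊕ Fin n) ℂ) ∈ L)
    (S : Set (Fin n → ℤ)) (hS : S.Finite)
    (hSL : ∀ a, IsStandard a →
      zmon (fun i => X (Sum.inl i)) (fun i => (X (Sum.inr i) : MvPolynomial (Fin n ⊕ Fin n) ℂ)) a ∉ L
      → a ∈ S) :
    Module.Finite ℂ (MvPolynomial (Fin n ⊕ Fin n) ℂ ⧸ L) ∧
      Module.finrank ℂ (MvPolynomial (Fin n ⊕ Fin n) ℂ ⧸ L) ≤ S.ncard := by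
  classical
  let z : (Fin n → ℤ) → MvPolynomial (Fin n ⊕ Fin n) ℂ :=
    zmon (fun i => X (Sum.inl i)) (fun i => X (Sum.inr i))
  let q : MvPolynomial (Fin n ⊕ Fin n) ℂ →ₗ[ℂ] (MvPolynomial (Fin n ⊕ Fin n) ℂ ⧸ L) :=
    (Ideal.Quotient.mkₐ ℂ L).toLinearMap
  let s : Set (MvPolynomial (Fin n ⊕ Fin n) ℂ ⧸ L) := (fun a => q (z a)) '' S
  have hq : Function.Surjective q := Ideal.Quotient.mk_surjective
  have hqL : ∀ f ∈ L, q f = 0 := fun f hf => Ideal.Quotient.eq_zero_iff_mem.mpr hf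
  have hz : ∀ a, z a ∈ (Submodule.span ℂ s).comap q := by
    refine zmon_mem_of_standard _ _ L huv heu hev _ ?_ ?_
    · intro f hf
      rw [Submodule.mem_comap, hqL f hf]
      exact Submodule.zero_mem _
    · intro a ha haL
      exact Submodule.subset_span ⟨a, hSL a ha haL, rfl⟩
  have htop : Submodule.span ℂ s = ⊤ := by
    rw [eq_top_iff]
    rintro x -
    obtain ⟨f, rfl⟩ := hq x
    change f ∈ (Submodule.span ℂ s).comap q
    induction f using MvPolynomial.induction_on' with
    | monomial m c =>
      have : monomial m c = c • monomial m (1 : ℂ) := by simp [smul_monomial]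
      rw [this]
      refine Submodule.smul_mem _ _ ?_
      rcases monomial_eq_zmon_or_mem L huv m with h | ⟨a, h⟩
      · rw [Submodule.mem_comap, hqL _ h]
        exact Submodule.zero_mem _
      · rw [h]; exact hz a
    | add p r hp hr => exact Submodule.add_mem _ hp hr
  have hs : s.Finite := hS.image _
  refine ⟨⟨⟨hs.toFinset, by simpa using htop⟩⟩, ?_⟩
  have := hs.fintype
  rw [← finrank_top, ← htop]
  calc Module.finrank ℂ (Submodule.span ℂ s) ≤ s.toFinset.card := finrank_span_le_card s
    _ = s.ncard := (Set.ncard_eq_toFinset_card' s).symm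
    _ ≤ S.ncard := Set.ncard_image_le hS

end Straightening

section Counting

variable {n : ℕ}

/-- The permutation listing the values `n * a i - i` in decreasing order. -/
lemma exists_strictAnti_perm (a : Fin n → ℤ) :
    ∃ w : Equiv.Perm (Fin n), StrictAnti fun k => (n : ℤ) * a (w k) - (w k : ℕ) := by
  let f : Fin n → ℤ := fun i => -((n : ℤ) * a i - (i : ℕ))
  refine ⟨Tuple.sort f, ?_⟩
  have hinj : Function.Injective f := by
    intro i j hij
    have h1 : (n : ℤ) * (a i - a j) = (i : ℕ) - (j : ℕ) := by
      simp only [f] at hij; linarith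
    have hi := i.2
    have hj := j.2
    have h2 : ((i : ℕ) : ℤ) - (j : ℕ) = 0 := by
      apply Int.eq_zero_of_abs_lt_dvd ⟨_, h1.symm⟩
      rw [abs_lt]; constructor <;> omega
    ext; omega
  have hm : StrictMono (f ∘ Tuple.sort f) :=
    (Tuple.monotone_sort f).strictMono_of_injective (hinj.comp (Tuple.sort f).injective)
  intro i j hij
  have := hm hij
  simp only [f, Function.comp_apply] at this
  simp only
  linarith

/-- A choice of permutation listing the values `n * a i - i` in decreasing order. -/
def sortPerm (a : Fin n → ℤ) : Equiv.Perm (Fin n) := (exists_strictAnti_perm a).choose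

lemma sortPerm_strictAnti (a : Fin n → ℤ) :
    StrictAnti fun k => (n : ℤ) * a (sortPerm a k) - (sortPerm a k : ℕ) :=
  (exists_strictAnti_perm a).choose_spec

lemma one_le_iff_pos (a : Fin n → ℤ) (i : Fin n) : 1 ≤ a i ↔ 0 < (n : ℤ) * a i - (i : ℕ) := by
  have hi := i.2
  constructor
  · intro h; nlinarith
  · intro h; by_contra! h'
    have : (n : ℤ) * a i ≤ 0 := by nlinarith
    omega

lemma le_neg_one_iff (a : Fin n → ℤ) (i : Fin n) :
    a i ≤ -1 ↔ (n : ℤ) * a i - (i : ℕ) ≤ -n := by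
  have hi := i.2
  constructor
  · intro h; nlinarith
  · intro h; by_contra! h'
    have : 0 ≤ (n : ℤ) * a i := by nlinarith
    omega

lemma sub_ne (a : Fin n → ℤ) {i j : Fin n} (hij : i ≠ j) :
    ((n : ℤ) * a i - (i : ℕ)) - (n * a j - (j : ℕ)) ≠ n := by
  intro h
  have h1 : (n : ℤ) * (a i - a j - 1) = (i : ℕ) - (j : ℕ) := by linarith
  have hi := i.2
  have hj := j.2
  have h2 : ((i : ℕ) : ℤ) - (j : ℕ) = 0 := by
    apply Int.eq_zero_of_abs_lt_dvd ⟨_, h1.symm⟩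
    rw [abs_lt]; constructor <;> omega
  exact hij (by ext; omega)

/-- Consecutive sorted values of a standard vector differ by less than `n`. -/
lemma IsStandard.gap_lt {a : Fin n → ℤ} (ha : IsStandard a) {w : Equiv.Perm (Fin n)}
    (hw : StrictAnti fun k => (n : ℤ) * a (w k) - (w k : ℕ)) {k l : Fin n} (hkl : (l : ℕ) = k + 1) :
    ((n : ℤ) * a (w k) - (w k : ℕ)) - (n * a (w l) - (w l : ℕ)) < n := by
  classical
  have hlt : k < l := by rw [Fin.lt_def]; omega
  by_contra! hge
  have hgt := lt_of_le_of_ne hge (sub_ne a (w.injective.ne hlt.ne)).symm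
  have hmem : ∀ (p : Fin n → Prop) [DecidablePred p] (i : Fin n),
      i ∈ (Finset.univ.filter p).map w.toEmbedding ↔ p (w.symm i) := by
    intro p _ i
    simp only [Finset.mem_map_equiv, Finset.mem_filter, Finset.mem_univ, true_and]
  have hle : ∀ i j : Fin n, i ≤ j → (n : ℤ) * a (w j) - (w j : ℕ) ≤ n * a (w i) - (w i : ℕ) :=
    fun i j hij => hw.antitone hij
  rcases le_or_gt 1 (a (w k)) with h1 | h1
  · refine ha.1 ((Finset.univ.filter fun j => j ≤ k).map w.toEmbedding)
      ⟨w k, by simp⟩ ?_ ?_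
    · intro i hi
      rw [hmem] at hi
      have := hle _ _ hi
      rw [w.apply_symm_apply] at this
      rw [one_le_iff_pos] at h1 ⊢
      linarith
    · intro i hi j hj
      rw [hmem] at hi hj
      have h2 := hle _ _ hi
      have h3 := hle l (w.symm j) (by rw [Fin.le_def]; rw [Fin.le_def] at hj; omega)
      rw [w.apply_symm_apply] at h2 h3
      linarith
  · rcases le_or_gt (a (w l)) (-1) with h2 | h2
    · refine ha.2 ((Finset.univ.filter fun j => l ≤ j).map w.toEmbedding)
        ⟨w l, by simp⟩ ?_ ?_
      · intro i hi
        rw [hmem] at hi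
        have := hle _ _ hi
        rw [w.apply_symm_apply] at this
        rw [le_neg_one_iff] at h2 ⊢
        linarith
      · intro i hi j hj
        rw [hmem] at hi hj
        have h2 := hle _ _ hi
        have h3 := hle (w.symm j) k (by rw [Fin.le_def]; rw [Fin.le_def] at hj; omega)
        rw [w.apply_symm_apply] at h2 h3
        linarith
    · have h3 := (one_le_iff_pos a (w k)).not.mp (by omega)
      have h4 := (le_neg_one_iff a (w l)).not.mp (by omega)
      linarith

/-- A standard vector is determined by its sorting permutation and the position of a zero. -/
lemma IsStandard.eq_of_sort {a b : Fin n → ℤ} (ha : IsStandard a) (hb : IsStandard b)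
    {w : Equiv.Perm (Fin n)} (hwa : StrictAnti fun k => (n : ℤ) * a (w k) - (w k : ℕ))
    (hwb : StrictAnti fun k => (n : ℤ) * b (w k) - (w k : ℕ))
    (k : Fin n) (hk : a (w k) = b (w k)) : a = b := by
  have hn : 0 < n := k.pos
  have step : ∀ m (hm : m + 1 < n), a (w ⟨m + 1, hm⟩) - b (w ⟨m + 1, hm⟩) =
      a (w ⟨m, by omega⟩) - b (w ⟨m, by omega⟩) := by
    intro m hm
    have h1 := ha.gap_lt hwa (k := ⟨m, by omega⟩) (l := ⟨m + 1, hm⟩) rfl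
    have h2 := hb.gap_lt hwb (k := ⟨m, by omega⟩) (l := ⟨m + 1, hm⟩) rfl
    have hlt : (⟨m, by omega⟩ : Fin n) < ⟨m + 1, hm⟩ := by simp [Fin.lt_def]
    have h3 := hwa hlt
    have h4 := hwb hlt
    simp only at h3 h4
    generalize a (w ⟨m + 1, hm⟩) = a1 at *
    generalize a (w ⟨m, _⟩) = a0 at *
    generalize b (w ⟨m + 1, hm⟩) = b1 at *
    generalize b (w ⟨m, _⟩) = b0 at *
    have h5 : (n : ℤ) * (a1 - b1 - (a0 - b0)) < n * 1 := by linarith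
    have h6 : (n : ℤ) * (-1) < n * (a1 - b1 - (a0 - b0)) := by linarith
    have hn' : (0 : ℤ) < n := by exact_mod_cast hn
    have h7 := lt_of_mul_lt_mul_left h5 hn'.le
    have h8 := lt_of_mul_lt_mul_left h6 hn'.le
    omega
  have key : ∀ m (hm : m < n), a (w ⟨m, hm⟩) - b (w ⟨m, hm⟩) = a (w ⟨0, hn⟩) - b (w ⟨0, hn⟩) := by
    intro m
    induction m with
    | zero => intro _; rfl
    | succ m ih => intro hm; rw [step m hm, ih]
  funext i
  have h1 := key _ (w.symm i).2
  have h2 := key _ k.2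
  simp only [Fin.eta, Equiv.apply_symm_apply] at h1 h2
  omega

lemma card_filter_perm (w : Equiv.Perm (Fin n)) (p : Fin n → Prop) [DecidablePred p] :
    (Finset.univ.filter fun k => p (w k)).card = (Finset.univ.filter p).card := by
  exact Finset.card_bijective w w.bijective fun i => by
    simp only [Finset.mem_filter, Finset.mem_univ, true_and]

/-- A decreasing predicate holds exactly on an initial segment. -/
lemma lt_card_filter_iff (p : Fin n → Prop) [DecidablePred p] (hp : ∀ i j, i ≤ j → p j → p i)
    (k : Fin n) : (k : ℕ) < (Finset.univ.filter p).card ↔ p k := by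
  constructor
  · intro h
    by_contra hk
    have : Finset.univ.filter p ⊆ Finset.Iio k := by
      intro i hi
      simp only [Finset.mem_filter, Finset.mem_univ, true_and] at hi
      rw [Finset.mem_Iio]
      by_contra! hki
      exact hk (hp _ _ hki hi)
    have := Finset.card_le_card this
    rw [Fin.card_Iio] at this
    omega
  · intro h
    have : Finset.Iic k ⊆ Finset.univ.filter p := by
      intro i hi
      simp only [Finset.mem_filter, Finset.mem_univ, true_and]
      exact hp _ _ (Finset.mem_Iic.mp hi) h
    have := Finset.card_le_card this
    rw [Fin.card_Iic] at this
    omega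

/-- The number of positive entries. -/
def posCount (a : Fin n → ℤ) : ℕ := (Finset.univ.filter fun i => 1 ≤ a i).card

lemma one_le_sortPerm_iff (a : Fin n → ℤ) (k : Fin n) :
    1 ≤ a (sortPerm a k) ↔ (k : ℕ) < posCount a := by
  rw [posCount, ← card_filter_perm (sortPerm a), lt_card_filter_iff]
  intro i j hij hj
  have := (sortPerm_strictAnti a).antitone hij
  rw [one_le_iff_pos] at hj ⊢
  linarith

lemma sortPerm_le_neg_one_iff (a : Fin n → ℤ) (k : Fin n) :
    a (sortPerm a k) ≤ -1 ↔ n ≤ k + posCount (-a) := by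
  have h : n - posCount (-a) = (Finset.univ.filter fun i => ¬ 1 ≤ (-a) i).card := by
    have := Finset.card_filter_add_card_filter_not (s := (Finset.univ : Finset (Fin n)))
      (fun i => 1 ≤ (-a) i)
    rw [Finset.card_univ, Fintype.card_fin] at this
    rw [posCount]
    omega
  have h2 : (k : ℕ) < n - posCount (-a) ↔ ¬ a (sortPerm a k) ≤ -1 := by
    rw [h, ← card_filter_perm (sortPerm a), lt_card_filter_iff]
    · simp only [Pi.neg_apply]; constructor <;> intro h <;> omega
    · intro i j hij hj
      have := (sortPerm_strictAnti a).antitone hij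
      simp only [Pi.neg_apply] at this hj ⊢
      have hj' := (le_neg_one_iff a (sortPerm a j)).not.mp (by omega)
      have := (le_neg_one_iff a (sortPerm a i)).not.mpr (by linarith)
      omega
  have h3 := h2.not
  rw [not_not] at h3
  rw [← h3]
  omega

/-- The first nonpositive sorted entry of a standard vector vanishes. -/
lemma IsStandard.sortPerm_posCount {a : Fin n → ℤ} (hn : 0 < n) (ha : IsStandard a) :
    ∃ h : posCount a < n, a (sortPerm a ⟨posCount a, h⟩) = 0 := by
  have : Nonempty (Fin n) := ⟨⟨0, hn⟩⟩
  have h : posCount a < n := by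
    by_contra! h
    refine ha.1 Finset.univ Finset.univ_nonempty (fun i _ => ?_) (fun i _ j hj => ?_)
    · have := (one_le_sortPerm_iff a ((sortPerm a).symm i)).mpr
        (lt_of_lt_of_le ((sortPerm a).symm i).2 h)
      simpa using this
    · exact absurd (Finset.mem_univ j) hj
  refine ⟨h, ?_⟩
  have h1 := (one_le_sortPerm_iff a ⟨posCount a, h⟩).not.mpr (by simp)
  suffices ¬ a (sortPerm a ⟨posCount a, h⟩) ≤ -1 by omega
  intro h2
  rcases Nat.eq_zero_or_pos (posCount a) with h0 | h0
  · refine ha.2 Finset.univ Finset.univ_nonempty (fun i _ => ?_) (fun i _ j hj => ?_)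
    · have := (sortPerm_strictAnti a).antitone (a := ⟨posCount a, h⟩) (b := (sortPerm a).symm i)
        (by rw [Fin.le_def]; simp [h0])
      simp only [Equiv.apply_symm_apply] at this
      rw [le_neg_one_iff] at h2 ⊢
      linarith
    · exact absurd (Finset.mem_univ j) hj
  · have h3 := (one_le_sortPerm_iff a ⟨posCount a - 1, by omega⟩).mpr (by simp only; omega)
    have h4 := ha.gap_lt (sortPerm_strictAnti a) (k := ⟨posCount a - 1, by omega⟩)
      (l := ⟨posCount a, h⟩) (by simp only; omega)
    rw [one_le_iff_pos] at h3
    rw [le_neg_one_iff] at h2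
    linarith

lemma injOn_sortPerm (p : ℕ) (hn : 0 < n) :
    Set.InjOn (sortPerm (n := n)) {a | IsStandard a ∧ posCount a = p} := by
  rintro a ⟨ha, hap⟩ b ⟨hb, hbp⟩ hab
  obtain ⟨h1, h2⟩ := ha.sortPerm_posCount hn
  obtain ⟨h3, h4⟩ := hb.sortPerm_posCount hn
  have h := sortPerm_strictAnti b
  rw [← hab] at h h4
  refine ha.eq_of_sort hb (sortPerm_strictAnti a) h ⟨posCount a, h1⟩ ?_
  rw [h2, ← h4]
  congr 3
  omega

/-- Half of the permutations are increasing at a given pair of positions. -/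
lemma two_mul_ncard_perm_lt {k l : Fin n} (hkl : k ≠ l) :
    2 * {w : Equiv.Perm (Fin n) | w k < w l}.ncard = n.factorial := by
  have h1 : {w : Equiv.Perm (Fin n) | w l < w k}.ncard =
      {w : Equiv.Perm (Fin n) | w k < w l}.ncard := by
    refine Set.ncard_congr (fun w _ => w * Equiv.swap k l) ?_ ?_ ?_
    · intro w hw; simpa using hw
    · intro w w' _ _ h; exact mul_right_cancel h
    · intro w hw
      refine ⟨w * Equiv.swap k l, by simpa using hw, ?_⟩
      rw [mul_assoc, Equiv.swap_mul_self, mul_one]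
  have h2 : {w : Equiv.Perm (Fin n) | w l < w k} = {w : Equiv.Perm (Fin n) | w k < w l}ᶜ := by
    ext w
    have : w k ≠ w l := w.injective.ne hkl
    simp only [Set.mem_ofPred_eq, Set.mem_compl_iff, not_lt]
    exact ⟨le_of_lt, fun h => lt_of_le_of_ne h this.symm⟩
  have h3 := Set.ncard_add_ncard_compl {w : Equiv.Perm (Fin n) | w k < w l}
  rw [← h2, h1, Nat.card_perm, Nat.card_fin] at h3
  omega

/-- Bound on the number of standard vectors with few positive and few negative entries. -/
lemma ncard_standard_pos_neg {i : ℕ} (hi : 1 ≤ i) (hin : i < n) :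
    {a : Fin n → ℤ | IsStandard a ∧ posCount a < i ∧ posCount (-a) < n - i}.Finite ∧
    2 * {a : Fin n → ℤ | IsStandard a ∧ posCount a < i ∧ posCount (-a) < n - i}.ncard ≤
      n.factorial := by
  let k : Fin n := ⟨i - 1, by omega⟩
  let l : Fin n := ⟨i, hin⟩
  have hzero : ∀ (a : Fin n → ℤ) (m : Fin n), posCount a < i → posCount (-a) < n - i →
      i - 1 ≤ m → (m : ℕ) ≤ i → a (sortPerm a m) = 0 := by
    intro a m h1 h2 h3 h4
    have h5 := (one_le_sortPerm_iff a m).not.mpr (by omega)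
    have h6 := (sortPerm_le_neg_one_iff a m).not.mpr (by omega)
    omega
  have hmaps : ∀ a ∈ {a : Fin n → ℤ | IsStandard a ∧ posCount a < i ∧ posCount (-a) < n - i},
      sortPerm a ∈ {w : Equiv.Perm (Fin n) | w k < w l} := by
    rintro a ⟨-, h1, h2⟩
    have hkl : k < l := by rw [Fin.lt_def]; simp only [k, l]; omega
    have h3 := sortPerm_strictAnti a hkl
    simp only at h3
    rw [hzero a k h1 h2 le_rfl (by simp only [k]; omega), hzero a l h1 h2 (by simp only [l]; omega)
      le_rfl] at h3
    simp only [Set.mem_ofPred_eq, Fin.lt_def]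
    omega
  have hinj : Set.InjOn (sortPerm (n := n))
      {a | IsStandard a ∧ posCount a < i ∧ posCount (-a) < n - i} := by
    rintro a ⟨ha, h1, h2⟩ b ⟨hb, h3, h4⟩ hab
    have h := sortPerm_strictAnti b
    have h5 := hzero b l h3 h4 (by simp only [l]; omega) le_rfl
    rw [← hab] at h h5
    refine ha.eq_of_sort hb (sortPerm_strictAnti a) h l ?_
    rw [h5, hzero a l h1 h2 (by simp only [l]; omega) le_rfl]
  refine ⟨Set.Finite.of_injOn hmaps hinj (Set.toFinite _), ?_⟩
  rw [← two_mul_ncard_perm_lt (k := k) (l := l) (by rw [Ne, Fin.ext_iff]; simp only [k, l]; omega)]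
  exact Nat.mul_le_mul_left 2 (Set.ncard_le_ncard_of_injOn _ hmaps hinj)

/-- Bound on the number of standard vectors with a given number of positive entries. -/
lemma ncard_standard_posCount_eq {p : ℕ} (hp : 1 ≤ p) :
    {a : Fin n → ℤ | IsStandard a ∧ posCount a = p}.Finite ∧
    2 * {a : Fin n → ℤ | IsStandard a ∧ posCount a = p}.ncard ≤ n.factorial := by
  rcases Nat.lt_or_ge p n with hpn | hpn
  · let k : Fin n := ⟨p - 1, by omega⟩
    let l : Fin n := ⟨p, hpn⟩
    have hmaps : ∀ a ∈ {a : Fin n → ℤ | IsStandard a ∧ posCount a = p},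
        sortPerm a ∈ {w : Equiv.Perm (Fin n) | w l < w k} := by
      rintro a ⟨ha, h1⟩
      obtain ⟨h2, h3⟩ := ha.sortPerm_posCount (by omega)
      have hl : (⟨posCount a, h2⟩ : Fin n) = l := by ext; exact h1
      rw [hl] at h3
      have h4 := ha.gap_lt (sortPerm_strictAnti a) (k := k) (l := l) (by simp only [k, l]; omega)
      have h5 := (one_le_sortPerm_iff a k).mpr (by simp only [k]; omega)
      rw [h3] at h4
      have h6 : (n : ℤ) * 1 ≤ n * a (sortPerm a k) := mul_le_mul_of_nonneg_left h5 (by positivity)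
      simp only [Set.mem_ofPred_eq, Fin.lt_def]
      omega
    have hinj := injOn_sortPerm (n := n) p (by omega)
    refine ⟨Set.Finite.of_injOn hmaps hinj (Set.toFinite _), ?_⟩
    rw [← two_mul_ncard_perm_lt (k := l) (l := k)
      (by rw [Ne, Fin.ext_iff]; simp only [k, l]; omega)]
    exact Nat.mul_le_mul_left 2 (Set.ncard_le_ncard_of_injOn _ hmaps hinj)
  · have : {a : Fin n → ℤ | IsStandard a ∧ posCount a = p} = ∅ := by
      rw [Set.eq_empty_iff_forall_notMem]
      rintro a ⟨ha, h1⟩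
      rcases Nat.eq_zero_or_pos n with h0 | h0
      · subst h0
        have : posCount a = 0 := by simp [posCount]
        omega
      · obtain ⟨h2, -⟩ := ha.sortPerm_posCount h0
        omega
    rw [this]
    simp

/-- Bound on the number of standard vectors with few positive entries. -/
lemma ncard_standard_posCount_le (hn : 0 < n) (i : ℕ) :
    {a : Fin n → ℤ | IsStandard a ∧ posCount a < i + 1}.Finite ∧
    2 * {a : Fin n → ℤ | IsStandard a ∧ posCount a < i + 1}.ncard ≤
      2 * n.factorial + i * n.factorial := by
  induction i with
  | zero =>
    have h : {a : Fin n → ℤ | IsStandard a ∧ posCount a < 0 + 1} =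
      {a : Fin n → ℤ | IsStandard a ∧ posCount a = 0} := by
      ext a; simp
    rw [h]
    have hinj := injOn_sortPerm (n := n) 0 hn
    have hmaps : ∀ a ∈ {a : Fin n → ℤ | IsStandard a ∧ posCount a = 0},
      sortPerm a ∈ (Set.univ : Set (Equiv.Perm (Fin n))) := fun _ _ => Set.mem_univ _
    refine ⟨Set.Finite.of_injOn hmaps hinj (Set.toFinite _), ?_⟩
    have := Set.ncard_le_ncard_of_injOn _ hmaps hinj
    rw [Set.ncard_univ, Nat.card_perm, Nat.card_fin] at this
    omega
  | succ i ih =>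
    have h : {a : Fin n → ℤ | IsStandard a ∧ posCount a < i + 1 + 1} =
      {a : Fin n → ℤ | IsStandard a ∧ posCount a < i + 1} ∪
      {a : Fin n → ℤ | IsStandard a ∧ posCount a = i + 1} := by
      ext a
      simp only [Set.mem_ofPred_eq, Set.mem_union, ← and_or_left]
      refine and_congr_right fun _ => ?_
      omega
    obtain ⟨h1, h2⟩ := ncard_standard_posCount_eq (n := n) (p := i + 1) (by omega)
    rw [h]
    refine ⟨ih.1.union h1, ?_⟩
    have := Set.ncard_union_le {a : Fin n → ℤ | IsStandard a ∧ posCount a < i + 1}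
      {a : Fin n → ℤ | IsStandard a ∧ posCount a = i + 1}
    have h3 : (i + 1) * n.factorial = i * n.factorial + n.factorial := by ring
    omega

end Counting

section GroupAlgebra

variable {k G V : Type*} [Field k] [Group G] [AddCommGroup V] [Module k V]
  [Module (MonoidAlgebra k G) V] [IsScalarTower k (MonoidAlgebra k G) V]

/-- A subspace stable under the group, as a submodule over the group algebra. -/
def stableSubmodule (W : Submodule k V)
    (hW : ∀ (g : G), ∀ f ∈ W, MonoidAlgebra.single g (1 : k) • f ∈ W) :
    Submodule (MonoidAlgebra k G) V where
  carrier := W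
  zero_mem' := W.zero_mem
  add_mem' := W.add_mem
  smul_mem' a f hf := by
    induction a using MonoidAlgebra.induction_linear with
    | zero => rw [zero_smul]; exact W.zero_mem
    | add a b ha hb => rw [add_smul]; exact W.add_mem ha hb
    | single g c =>
      have : MonoidAlgebra.single g c = c • MonoidAlgebra.single g (1 : k) := by
        rw [MonoidAlgebra.smul_single, smul_eq_mul, mul_one]
      rw [this, smul_assoc]
      exact W.smul_mem _ (hW g f hf)

/-- The quotient by a stable subspace is the quotient by the associated submodule. -/
def stableQuotientEquiv (W : Submodule k V) (hW) :
    (V ⧸ stableSubmodule (G := G) W hW) ≃ₗ[k] (V ⧸ W) :=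
  (Submodule.Quotient.restrictScalarsEquiv k (stableSubmodule (G := G) W hW)).symm ≪≫ₗ
    Submodule.quotEquivOfEq _ _ (by ext; rfl)

end GroupAlgebra

section XYPoly

variable (n : ℕ)

/-- The polynomial ring in the variables `x_i` and `y_i`. -/
abbrev XYPoly : Type := MvPolynomial (Fin n ⊕ Fin n) ℂ

/-- The group algebra of the symmetric group. -/
abbrev GrpAlg : Type := MonoidAlgebra ℂ (Equiv.Perm (Fin n))

/-- The action of a permutation on polynomials. -/
abbrev polyAct (σ : Equiv.Perm (Fin n)) : XYPoly n →ₐ[ℂ] XYPoly n := rename (Sum.map ⇑σ ⇑σ)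

/-- The representation of the symmetric group on polynomials. -/
def polyRep : Representation ℂ (Equiv.Perm (Fin n)) (XYPoly n) where
  toFun σ := (polyAct n σ).toLinearMap
  map_one' := by
    refine LinearMap.ext fun f => ?_
    change rename (Sum.map id id) f = f
    rw [Sum.map_id_id, rename_id_apply]
  map_mul' σ τ := by
    refine LinearMap.ext fun f => ?_
    change rename (Sum.map (σ ∘ τ) (σ ∘ τ)) f = rename (Sum.map σ σ) (rename (Sum.map τ τ) f)
    rw [rename_rename, Sum.map_comp_map]

instance : Module (GrpAlg n) (XYPoly n) :=
  Module.compHom _ (polyRep n).asAlgebraHom.toRingHom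

instance : IsScalarTower ℂ (GrpAlg n) (XYPoly n) :=
  ⟨fun c a v => by
    change (polyRep n).asAlgebraHom (c • a) v = c • (polyRep n).asAlgebraHom a v
    rw [map_smul]
    rfl⟩

variable {n}

lemma single_smul_poly (σ : Equiv.Perm (Fin n)) (f : XYPoly n) :
    (MonoidAlgebra.single σ (1 : ℂ) : GrpAlg n) • f = polyAct n σ f := by
  change (polyRep n).asAlgebraHom (MonoidAlgebra.single σ 1) f = _
  rw [Representation.asAlgebraHom_single_one]
  rfl

variable (n) in
/-- Homogeneous components, as maps of modules over the group algebra. -/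
def homComp (d : ℕ) : XYPoly n →ₗ[GrpAlg n] XYPoly n :=
  MonoidAlgebra.equivariantOfLinearOfComm (homogeneousComponent d) fun σ f => by
    rw [single_smul_poly, single_smul_poly, rename_homogeneousComponent]

lemma homComp_apply (d : ℕ) (f : XYPoly n) : homComp n d f = homogeneousComponent d f := rfl

lemma homComp_homComp (d e : ℕ) (f : XYPoly n) :
    homComp n e (homComp n d f) = if e = d then homComp n d f else 0 := by
  simp only [homComp_apply]
  exact homogeneousComponent_of_mem (homogeneousComponent_mem d f)

lemma homComp_mul_X (d : ℕ) (f : XYPoly n) (v : Fin n ⊕ Fin n) :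
    homComp n (d + 1) (f * X v) = homComp n d f * X v := by
  classical
  ext m
  simp only [homComp_apply, coeff_homogeneousComponent, coeff_mul_X']
  by_cases hv : v ∈ m.support
  · simp only [hv, if_true]
    have hle : Finsupp.single v 1 ≤ m := by
      rw [Finsupp.single_le_iff]
      exact Nat.one_le_iff_ne_zero.mpr (Finsupp.mem_support_iff.mp hv)
    have : m.degree = (m - Finsupp.single v 1).degree + 1 := by
      conv_lhs => rw [← tsub_add_cancel_of_le hle]
      rw [map_add, Finsupp.degree_single]
    simp only [this, Nat.add_right_cancel_iff]
  · simp [hv]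

lemma homComp_zero_mul_X (f : XYPoly n) (v : Fin n ⊕ Fin n) : homComp n 0 (f * X v) = 0 := by
  rw [homComp_apply, homogeneousComponent_zero]
  classical
  rw [coeff_mul_X']
  simp

lemma exists_homComp_eq_zero (f : XYPoly n) : ∃ N, ∀ e ≥ N, homComp n e f = 0 :=
  ⟨f.totalDegree + 1, fun e he => homogeneousComponent_eq_zero e f (by omega)⟩

lemma eq_zero_of_homComp (f : XYPoly n) (h : ∀ d, homComp n d f = 0) : f = 0 := by
  rw [← sum_homogeneousComponent f]
  exact Finset.sum_eq_zero fun d _ => h d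

/-- The ideal of leading forms of an ideal. -/
def leadingIdeal (I : Ideal (XYPoly n)) : Ideal (XYPoly n) where
  carrier := {f | ∀ d, ∃ g ∈ I, (∀ e > d, homComp n e g = 0) ∧ homComp n d g = homComp n d f}
  zero_mem' d := ⟨0, I.zero_mem, by simp⟩
  add_mem' {f f'} hf hf' d := by
    obtain ⟨g, hg, h1, h2⟩ := hf d
    obtain ⟨g', hg', h1', h2'⟩ := hf' d
    exact ⟨g + g', I.add_mem hg hg', fun e he => by rw [map_add, h1 e he, h1' e he, add_zero],
      by rw [map_add, map_add, h2, h2']⟩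
  smul_mem' c := by
    simp only [Set.mem_ofPred_eq, smul_eq_mul]
    induction c using MvPolynomial.induction_on with
    | C a =>
      intro f hf d
      obtain ⟨g, hg, h1, h2⟩ := hf d
      refine ⟨C a * g, I.mul_mem_left _ hg, fun e he => ?_, ?_⟩
      · rw [homComp_apply, homogeneousComponent_C_mul, ← homComp_apply, h1 e he, mul_zero]
      · simp only [homComp_apply, homogeneousComponent_C_mul] at h2 ⊢
        rw [h2]
    | add p q hp hq =>
      intro f hf d
      obtain ⟨g, hg, h1, h2⟩ := hp hf d
      obtain ⟨g', hg', h1', h2'⟩ := hq hf d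
      exact ⟨g + g', I.add_mem hg hg', fun e he => by rw [map_add, h1 e he, h1' e he, add_zero],
        by rw [add_mul, map_add, map_add, h2, h2']⟩
    | mul_X p v hp =>
      intro f hf d
      rw [mul_assoc, mul_comm, mul_assoc, mul_comm f]
      rw [← mul_assoc, mul_comm (X v)]
      cases d with
      | zero => exact ⟨0, I.zero_mem, by simp, by
          rw [mul_comm, ← mul_assoc, homComp_zero_mul_X, map_zero]⟩
      | succ d =>
        obtain ⟨g, hg, h1, h2⟩ := hp hf d
        refine ⟨g * X v, I.mul_mem_right _ hg, fun e he => ?_, ?_⟩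
        · obtain ⟨e, rfl⟩ : ∃ e', e = e' + 1 := ⟨e - 1, by omega⟩
          rw [homComp_mul_X, h1 e (by omega), zero_mul]
        · rw [homComp_mul_X, h2, ← homComp_mul_X]
          exact congrArg _ (by ring)

lemma homComp_mem_leadingIdeal {I : Ideal (XYPoly n)} {f : XYPoly n} (hf : f ∈ leadingIdeal I)
    (d : ℕ) : homComp n d f ∈ leadingIdeal I := by
  intro e
  rw [homComp_homComp]
  split_ifs with h
  · subst h
    exact hf e
  · exact ⟨0, I.zero_mem, by simp⟩

lemma homComp_mem_leadingIdeal_of_mem {I : Ideal (XYPoly n)} {f : XYPoly n} {d : ℕ} (hf : f ∈ I)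
    (hd : ∀ e > d, homComp n e f = 0) : homComp n d f ∈ leadingIdeal I := by
  intro e
  rw [homComp_homComp]
  split_ifs with h
  · subst h
    exact ⟨f, hf, hd, rfl⟩
  · exact ⟨0, I.zero_mem, by simp⟩

lemma mem_leadingIdeal_of_isHomogeneous {I : Ideal (XYPoly n)} {f : XYPoly n} {d : ℕ} (hf : f ∈ I)
    (hd : f.IsHomogeneous d) : f ∈ leadingIdeal I := by
  have h : ∀ e, homComp n e f = if e = d then f else 0 :=
    fun e => homogeneousComponent_of_mem hd
  have := homComp_mem_leadingIdeal_of_mem (d := d) hf fun e he => by rw [h, if_neg he.ne']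
  rwa [h, if_pos rfl] at this

/-- An ideal is stable if it is invariant under permutations. -/
def IsStable (I : Ideal (XYPoly n)) : Prop := ∀ σ, ∀ f ∈ I, polyAct n σ f ∈ I

lemma IsStable.leading {I : Ideal (XYPoly n)} (hI : IsStable I) :
    IsStable (leadingIdeal I) := by
  intro σ f hf d
  obtain ⟨g, hg, h1, h2⟩ := hf d
  refine ⟨polyAct n σ g, hI σ g hg, fun e he => ?_, ?_⟩
  · rw [← single_smul_poly, map_smul, h1 e he, smul_zero]
  · rw [← single_smul_poly, ← single_smul_poly, map_smul, h2, map_smul]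

/-- A stable ideal as a submodule over the group algebra. -/
def IsStable.toSub {I : Ideal (XYPoly n)} (hI : IsStable I) : Submodule (GrpAlg n) (XYPoly n) :=
  stableSubmodule (I.restrictScalars ℂ) fun σ f hf => by
    rw [single_smul_poly]
    exact hI σ f hf

lemma IsStable.mem_toSub {I : Ideal (XYPoly n)} {hI : IsStable I} {f : XYPoly n} :
    f ∈ hI.toSub ↔ f ∈ I := Iff.rfl

/-- The quotient by a stable ideal is isomorphic to the quotient by its leading ideal. -/
lemma IsStable.nonempty_quotient_leadingIdeal {I : Ideal (XYPoly n)} (hI : IsStable I) :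
    Nonempty ((XYPoly n ⧸ hI.toSub) ≃ₗ[GrpAlg n] (XYPoly n ⧸ hI.leading.toSub)) := by
  let D : ℕ → Submodule (GrpAlg n) (XYPoly n) := fun d => LinearMap.range (homComp n d)
  have hD : ∀ d f, f ∈ D d → homComp n d f = f := by
    rintro d _ ⟨f, rfl⟩
    rw [homComp_homComp, if_pos rfl]
  have hD' : ∀ d e f, f ∈ D d → e ≠ d → homComp n e f = 0 := by
    rintro d e _ ⟨f, rfl⟩ he
    rw [homComp_homComp, if_neg he]
  choose C' hC' using fun d => exists_isCompl (hI.leading.toSub ⊓ D d)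
  let C : ℕ → Submodule (GrpAlg n) (XYPoly n) := fun d => C' d ⊓ D d
  have hCsup : ∀ d f, f ∈ D d →
      ∃ g ∈ leadingIdeal I, ∃ c ∈ C d, g ∈ D d ∧ g + c = f := by
    intro d f hf
    have : f ∈ (hI.leading.toSub ⊓ D d) ⊔ C' d := by
      rw [(hC' d).sup_eq_top]; trivial
    obtain ⟨g, hg, c, hc, rfl⟩ := Submodule.mem_sup.mp this
    refine ⟨g, hg.1, c, ⟨hc, ?_⟩, hg.2, rfl⟩
    simpa using (D d).sub_mem hf hg.2
  have hCinf : ∀ d f, f ∈ C d → f ∈ leadingIdeal I → f = 0 := by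
    intro d f hf hf'
    have : f ∈ (hI.leading.toSub ⊓ D d) ⊓ C' d := ⟨⟨hf', hf.2⟩, hf.1⟩
    rw [(hC' d).inf_eq_bot] at this
    exact (Submodule.mem_bot _).mp this
  let H : Submodule (GrpAlg n) (XYPoly n) := ⨅ d, (C d).comap (homComp n d)
  have hH : ∀ f, f ∈ H ↔ ∀ d, homComp n d f ∈ C d := by
    intro f
    simp only [H, Submodule.mem_iInf, Submodule.mem_comap]
  have hCH : ∀ d, C d ≤ H := by
    intro d c hc
    rw [hH]
    intro e
    rcases eq_or_ne e d with rfl | he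
    · rwa [hD e c hc.2]
    · rw [hD' d e c hc.2 he]
      exact Submodule.zero_mem _
  have hlead : IsCompl hI.leading.toSub H := by
    constructor
    · rw [Submodule.disjoint_def]
      intro f hf hf'
      refine eq_zero_of_homComp f fun d => ?_
      exact hCinf d _ ((hH f).mp hf' d) (homComp_mem_leadingIdeal hf d)
    · rw [codisjoint_iff, Submodule.eq_top_iff']
      intro f
      rw [← sum_homogeneousComponent f]
      refine Submodule.sum_mem _ fun d _ => ?_
      obtain ⟨g, hg, c, hc, -, h⟩ := hCsup d (homComp n d f) ⟨f, rfl⟩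
      rw [← homComp_apply, ← h]
      exact Submodule.add_mem_sup hg (hCH d hc)
  have hideal : IsCompl hI.toSub H := by
    constructor
    · rw [Submodule.disjoint_def]
      intro f hf hf'
      have : ∀ N, (∀ e ≥ N, homComp n e f = 0) → f = 0 := by
        intro N
        induction N with
        | zero => exact fun h => eq_zero_of_homComp f fun d => h d (Nat.zero_le _)
        | succ N ih =>
          intro h
          refine ih fun e he => ?_
          rcases Nat.eq_or_lt_of_le he with rfl | he
          · exact hCinf N _ ((hH f).mp hf' N) (homComp_mem_leadingIdeal_of_mem hf h)
          · exact h e he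
      exact (exists_homComp_eq_zero f).elim this
    · rw [codisjoint_iff, Submodule.eq_top_iff']
      intro f
      have : ∀ N f, (∀ e ≥ N, homComp n e f = 0) → f ∈ hI.toSub ⊔ H := by
        intro N
        induction N with
        | zero =>
          intro f h
          rw [eq_zero_of_homComp f fun d => h d (Nat.zero_le _)]
          exact Submodule.zero_mem _
        | succ N ih =>
          intro f h
          obtain ⟨g, hg, c, hc, hgD, hgc⟩ := hCsup N (homComp n N f) ⟨f, rfl⟩
          obtain ⟨g', hg', h1, h2⟩ := hg N
          have h3 : f - (g' + c) ∈ hI.toSub ⊔ H := by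
            refine ih _ fun e he => ?_
            rw [map_sub, map_add]
            rcases Nat.eq_or_lt_of_le he with rfl | he
            · rw [h2, hD _ g hgD, hD _ c hc.2, hgc, sub_self]
            · rw [h e he, h1 e he, hD' _ _ c hc.2 (ne_of_gt he), add_zero, sub_zero]
          have h4 : g' + c ∈ hI.toSub ⊔ H := Submodule.add_mem_sup hg' (hCH N hc)
          simpa using Submodule.add_mem _ h3 h4
      obtain ⟨N, hN⟩ := exists_homComp_eq_zero f
      exact this N f hN
  exact ⟨Submodule.quotientEquivOfIsCompl _ H hideal ≪≫ₗ
    (Submodule.quotientEquivOfIsCompl _ H hlead).symm⟩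

end XYPoly

section Regular

variable (n : ℕ)

/-- Complex functions on the symmetric group, acted on by right translation. -/
def Reg : Type := Equiv.Perm (Fin n) → ℂ

instance : AddCommGroup (Reg n) := inferInstanceAs (AddCommGroup (Equiv.Perm (Fin n) → ℂ))

instance : Module ℂ (Reg n) := inferInstanceAs (Module ℂ (Equiv.Perm (Fin n) → ℂ))

instance : Module.Finite ℂ (Reg n) :=
  inferInstanceAs (Module.Finite ℂ (Equiv.Perm (Fin n) → ℂ))

lemma finrank_reg : Module.finrank ℂ (Reg n) = n.factorial := by
  change Module.finrank ℂ (Equiv.Perm (Fin n) → ℂ) = _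
  rw [Module.finrank_fintype_fun_eq_card, Fintype.card_perm, Fintype.card_fin]

/-- The right regular representation. -/
def regRep : Representation ℂ (Equiv.Perm (Fin n)) (Reg n) where
  toFun τ :=
    { toFun := fun g σ => g (σ * τ)
      map_add' := fun _ _ => rfl
      map_smul' := fun _ _ => rfl }
  map_one' := by
    refine LinearMap.ext fun g => funext fun σ => ?_
    change g (σ * 1) = g σ
    rw [mul_one]
  map_mul' τ₁ τ₂ := by
    refine LinearMap.ext fun g => funext fun σ => ?_
    change g (σ * (τ₁ * τ₂)) = g (σ * τ₁ * τ₂)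
    rw [mul_assoc]

instance : Module (GrpAlg n) (Reg n) :=
  Module.compHom _ (regRep n).asAlgebraHom.toRingHom

instance : IsScalarTower ℂ (GrpAlg n) (Reg n) :=
  ⟨fun c a v => by
    change (regRep n).asAlgebraHom (c • a) v = c • (regRep n).asAlgebraHom a v
    rw [map_smul]
    rfl⟩

variable {n}

lemma single_smul_reg (τ : Equiv.Perm (Fin n)) (g : Reg n) (σ : Equiv.Perm (Fin n)) :
    ((MonoidAlgebra.single τ (1 : ℂ) : GrpAlg n) • g) σ = g (σ * τ) := by
  change ((regRep n).asAlgebraHom (MonoidAlgebra.single τ 1) g) σ = _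
  rw [Representation.asAlgebraHom_single_one]
  rfl

variable (n) in
/-- Functions multiplied by `c` under left translation by the last transposition. -/
def swapEigen (c : ℂ) : Submodule (GrpAlg n) (Reg n) :=
  stableSubmodule (k := ℂ)
    { carrier := {g | ∀ σ, g (swapLast n * σ) = c * g σ}
      zero_mem' := fun σ => (mul_zero c).symm
      add_mem' := by
        intro g h hg hh σ
        change g _ + h _ = c * (g σ + h σ)
        rw [hg, hh, mul_add]
      smul_mem' := by
        intro a g hg σ
        change a * g _ = c * (a * g σ)
        rw [hg, mul_left_comm] }
    (by
      intro τ g hg σ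
      rw [single_smul_reg, single_smul_reg, mul_assoc, hg])

lemma mem_swapEigen {c : ℂ} {g : Reg n} :
    g ∈ swapEigen n c ↔ ∀ σ, g (swapLast n * σ) = c * g σ := Iff.rfl

lemma swapLast_mul_self : swapLast n * swapLast n = 1 := by
  rw [swapLast]
  split_ifs
  · exact Equiv.swap_mul_self _ _
  · exact one_mul 1

lemma swapLast_mul_swapLast_mul (σ : Equiv.Perm (Fin n)) : swapLast n * (swapLast n * σ) = σ := by
  rw [← mul_assoc, swapLast_mul_self, one_mul]

lemma isCompl_swapEigen : IsCompl (swapEigen n 1) (swapEigen n (-1)) := by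
  constructor
  · rw [Submodule.disjoint_def]
    intro g h1 h2
    funext σ
    have h3 := h1 σ
    rw [h2 σ] at h3
    change g σ = 0
    linear_combination (-1 / 2) * h3
  · rw [codisjoint_iff, Submodule.eq_top_iff']
    intro g
    let g₁ : Reg n := fun σ => (g σ + g (swapLast n * σ)) / 2
    let g₂ : Reg n := fun σ => (g σ - g (swapLast n * σ)) / 2
    have h : g = g₁ + g₂ := by
      funext σ
      change g σ = (g σ + g (swapLast n * σ)) / 2 + (g σ - g (swapLast n * σ)) / 2
      ring
    rw [h]
    refine Submodule.add_mem_sup (fun σ => ?_) (fun σ => ?_)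
    · simp only [g₁, swapLast_mul_swapLast_mul]
      ring
    · simp only [g₂, swapLast_mul_swapLast_mul]
      ring

instance (c : ℂ) : Module.Finite ℂ (swapEigen n c) :=
  Module.Finite.of_injective ((swapEigen n c).subtype.restrictScalars ℂ)
    Subtype.val_injective

lemma sign_swapLast (hn : 2 ≤ n) : Equiv.Perm.sign (swapLast n) = -1 := by
  rw [swapLast, dif_pos hn, Equiv.Perm.sign_swap]
  rw [Ne, Fin.mk.injEq]
  omega

/-- Twisting by the sign character exchanges invariant and anti-invariant functions. -/
def signTwist (hn : 2 ≤ n) (c : ℂ) : swapEigen n c →ₗ[ℂ] swapEigen n (-c) where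
  toFun g := ⟨fun σ => ((Equiv.Perm.sign σ : ℤ) : ℂ) * g.1 σ, fun σ => by
    have := g.2 σ
    simp only [this, map_mul, sign_swapLast hn]
    push_cast
    ring⟩
  map_add' g h := Subtype.ext (funext fun σ => mul_add _ (g.1 σ) (h.1 σ))
  map_smul' a g := Subtype.ext (funext fun σ => mul_left_comm _ a (g.1 σ))

lemma signTwist_injective (hn : 2 ≤ n) (c : ℂ) : Function.Injective (signTwist hn c) := by
  intro g h hgh
  refine Subtype.ext (funext fun σ => ?_)
  have h1 := congrFun (congrArg Subtype.val hgh) σ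
  refine mul_left_cancel₀ ?_ h1
  exact_mod_cast (Equiv.Perm.sign σ).ne_zero

lemma two_mul_finrank_swapEigen (hn : 2 ≤ n) :
    2 * Module.finrank ℂ (swapEigen n 1) = n.factorial ∧
    2 * Module.finrank ℂ (swapEigen n (-1)) = n.factorial := by
  have h1 := LinearMap.finrank_le_finrank_of_injective (signTwist_injective hn 1)
  have h2 := LinearMap.finrank_le_finrank_of_injective (signTwist_injective hn (-1))
  rw [neg_neg] at h2
  have h3 := ((Submodule.prodEquivOfIsCompl _ _ (isCompl_swapEigen (n := n))).restrictScalars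
    ℂ).finrank_eq
  rw [Module.finrank_prod, finrank_reg] at h3
  omega

end Regular

section Evaluation

variable {n : ℕ}

lemma exists_eval_eq {τ : Type*} (S : Finset (τ → ℂ)) (g : (τ → ℂ) → ℂ) :
    ∃ f : MvPolynomial τ ℂ, ∀ x ∈ S, eval x f = g x := by
  classical
  have key : ∀ x y : τ → ℂ, ∃ f : MvPolynomial τ ℂ, x ≠ y → eval x f = 1 ∧ eval y f = 0 := by
    intro x y
    by_cases h : x = y
    · exact ⟨0, fun h' => absurd h h'⟩
    · obtain ⟨v, hv⟩ := Function.ne_iff.mp h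
      refine ⟨C (x v - y v)⁻¹ * (X v - C (y v)), fun _ => ⟨?_, ?_⟩⟩
      · simp [inv_mul_cancel₀ (sub_ne_zero.mpr hv)]
      · simp
  choose F hF using key
  refine ⟨∑ y ∈ S, C (g y) * ∏ z ∈ S.erase y, F y z, fun x hx => ?_⟩
  rw [map_sum, Finset.sum_eq_single x]
  · rw [map_mul, eval_C, map_prod, Finset.prod_eq_one, mul_one]
    intro z hz
    exact (hF x z (Finset.ne_of_mem_erase hz).symm).1
  · intro y _ hyx
    rw [map_mul, map_prod, Finset.prod_eq_zero (Finset.mem_erase.mpr ⟨hyx.symm, hx⟩), mul_zero]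
    exact (hF y x hyx).2
  · exact fun h => absurd hx h

/-- Evaluation of polynomials along the orbit of a point, as a linear map. -/
def evalLin (p : Fin n ⊕ Fin n → ℂ) : XYPoly n →ₗ[ℂ] Reg n where
  toFun f := fun σ => eval (p ∘ Sum.map σ σ) f
  map_add' f g := funext fun _ => map_add _ f g
  map_smul' c f := funext fun _ => smul_eval _ f c

/-- Evaluation of polynomials along the orbit of a point, as an equivariant map. -/
def evalReg (p : Fin n ⊕ Fin n → ℂ) : XYPoly n →ₗ[GrpAlg n] Reg n :=
  MonoidAlgebra.equivariantOfLinearOfComm (evalLin p) fun τ f => by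
    funext σ
    rw [single_smul_reg, single_smul_poly]
    change eval (p ∘ Sum.map σ σ) (rename (Sum.map τ τ) f) = eval (p ∘ Sum.map (σ ∘ τ) (σ ∘ τ)) f
    rw [eval_rename, Function.comp_assoc, Sum.map_comp_map]

lemma evalReg_apply (p : Fin n ⊕ Fin n → ℂ) (f : XYPoly n) (σ : Equiv.Perm (Fin n)) :
    evalReg p f σ = eval (p ∘ Sum.map σ σ) f := rfl

/-- The ideal of polynomials vanishing on the orbit of a point. -/
def orbitIdeal (p : Fin n ⊕ Fin n → ℂ) : Ideal (XYPoly n) :=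
  ⨅ σ : Equiv.Perm (Fin n), RingHom.ker (eval (p ∘ Sum.map σ σ))

lemma mem_orbitIdeal {p : Fin n ⊕ Fin n → ℂ} {f : XYPoly n} :
    f ∈ orbitIdeal p ↔ ∀ σ : Equiv.Perm (Fin n), eval (p ∘ Sum.map σ σ) f = 0 := by
  simp only [orbitIdeal, Submodule.mem_iInf, RingHom.mem_ker]

lemma ker_evalReg (p : Fin n ⊕ Fin n → ℂ) (f : XYPoly n) :
    f ∈ LinearMap.ker (evalReg p) ↔ f ∈ orbitIdeal p := by
  rw [LinearMap.mem_ker, mem_orbitIdeal]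
  constructor
  · intro h σ
    rw [← evalReg_apply, h]
    rfl
  · intro h
    funext σ
    rw [evalReg_apply, h]
    rfl

lemma isStable_orbitIdeal (p : Fin n ⊕ Fin n → ℂ) : IsStable (orbitIdeal p) := by
  intro σ f hf
  rw [← ker_evalReg] at hf ⊢
  rw [← single_smul_poly]
  exact Submodule.smul_mem _ _ hf

lemma mem_range_evalReg {p : Fin n ⊕ Fin n → ℂ} {g : Reg n}
    (hg : ∀ σ τ : Equiv.Perm (Fin n), p ∘ Sum.map σ σ = p ∘ Sum.map τ τ → g σ = g τ) :
    g ∈ LinearMap.range (evalReg p) := by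
  classical
  obtain ⟨f, hf⟩ := exists_eval_eq
    (Finset.univ.image fun σ : Equiv.Perm (Fin n) => p ∘ Sum.map σ σ)
    (fun x => if h : ∃ σ : Equiv.Perm (Fin n), p ∘ Sum.map σ σ = x then g h.choose else 0)
  refine ⟨f, funext fun σ => ?_⟩
  have h : ∃ τ : Equiv.Perm (Fin n), p ∘ Sum.map τ τ = p ∘ Sum.map σ σ := ⟨σ, rfl⟩
  rw [evalReg_apply, hf _ (Finset.mem_image_of_mem _ (Finset.mem_univ σ)), dif_pos h]
  exact hg _ _ h.choose_spec

/-- The quotient by the leading ideal of an orbit ideal is the space of functions on the orbit. -/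
lemma nonempty_quotient_leadingIdeal_equiv (p : Fin n ⊕ Fin n → ℂ)
    (N : Submodule (GrpAlg n) (Reg n)) (hN : LinearMap.range (evalReg p) = N) :
    Nonempty ((XYPoly n ⧸ (isStable_orbitIdeal p).leading.toSub) ≃ₗ[GrpAlg n] N) := by
  subst hN
  obtain ⟨e⟩ := (isStable_orbitIdeal p).nonempty_quotient_leadingIdeal
  refine ⟨e.symm ≪≫ₗ Submodule.quotEquivOfEq _ _ ?_ ≪≫ₗ (evalReg p).quotKerEquivRange⟩
  ext f
  exact (ker_evalReg p f).symm

/-- The point with `x`-coordinates `1, …, a` and `y`-coordinates `a + 1, …, b` in the positions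
indexed by these numbers, and zeros elsewhere. -/
def stdPoint (n a b : ℕ) : Fin n ⊕ Fin n → ℂ :=
  Sum.elim (fun j => if (j : ℕ) < a then (j : ℕ) + 1 else 0)
    (fun j => if a ≤ (j : ℕ) ∧ (j : ℕ) < b then (j : ℕ) + 1 else 0)

lemma stdPoint_mul (a b : ℕ) (j : Fin n) :
    stdPoint n a b (Sum.inl j) * stdPoint n a b (Sum.inr j) = 0 := by
  simp only [stdPoint, Sum.elim_inl, Sum.elim_inr, mul_eq_zero]
  by_cases h : (j : ℕ) < a
  · right; rw [if_neg (by omega)]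
  · left; rw [if_neg h]

/-- The sum of the two coordinates of a standard point. -/
lemma stdPoint_add {a b : ℕ} (hab : a ≤ b) (j : Fin n) :
    stdPoint n a b (Sum.inl j) + stdPoint n a b (Sum.inr j) =
      ((if (j : ℕ) < b then (j : ℕ) + 1 else 0 : ℕ) : ℂ) := by
  simp only [stdPoint, Sum.elim_inl, Sum.elim_inr]
  split_ifs <;> first | omega | simp

lemma stdPoint_comp_eq {a b : ℕ} (hab : a ≤ b) {σ τ : Equiv.Perm (Fin n)}
    (h : stdPoint n a b ∘ Sum.map σ σ = stdPoint n a b ∘ Sum.map τ τ) (j : Fin n) :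
    σ j = τ j ∨ (b ≤ σ j ∧ b ≤ τ j) := by
  have h1 := congrFun h (Sum.inl j)
  have h2 := congrFun h (Sum.inr j)
  simp only [Function.comp_apply, Sum.map_inl, Sum.map_inr] at h1 h2
  have h3 := stdPoint_add hab (σ j)
  rw [h1, h2, stdPoint_add hab, Nat.cast_inj] at h3
  rw [Fin.ext_iff]
  split_ifs at h3 <;> omega

lemma range_evalReg_stdPoint_top {i : ℕ} (hi : i ≤ n - 1) :
    LinearMap.range (evalReg (stdPoint n i (n - 1))) = ⊤ := by
  rw [Submodule.eq_top_iff']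
  intro g
  refine mem_range_evalReg fun σ τ h => ?_
  refine congrArg g ?_
  ext j
  rcases stdPoint_comp_eq hi h j with h | h
  · rw [h]
  · have := (σ j).2
    have := (τ j).2
    omega

lemma stdPoint_comp_swapLast (a : ℕ) (ha : a ≤ n - 2) (σ : Equiv.Perm (Fin n)) :
    stdPoint n a (n - 2) ∘ Sum.map (swapLast n * σ) (swapLast n * σ) =
      stdPoint n a (n - 2) ∘ Sum.map σ σ := by
  have key : ∀ j, stdPoint n a (n - 2) (Sum.map (swapLast n) (swapLast n) j) =
      stdPoint n a (n - 2) j := by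
    by_cases hn : 2 ≤ n
    · have h : ∀ j : Fin n, (j : ℕ) < n - 2 → swapLast n j = j := by
        intro j hj
        rw [swapLast, dif_pos hn, Equiv.swap_apply_of_ne_of_ne] <;>
        · rw [Ne, Fin.ext_iff]
          simp only
          omega
      have h' : ∀ j : Fin n, n - 2 ≤ (j : ℕ) → n - 2 ≤ (swapLast n j : ℕ) := by
        intro j hj
        by_contra! hlt
        have h1 := h _ hlt
        rw [← Equiv.Perm.mul_apply, swapLast_mul_self] at h1
        rw [← h1] at hlt
        exact absurd hj (not_le.mpr hlt)
      rintro (j | j) <;> rcases Nat.lt_or_ge j (n - 2) with hj | hj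
      · rw [Sum.map_inl, h j hj]
      · have := h' j hj
        simp only [stdPoint, Sum.map_inl, Sum.elim_inl]
        rw [if_neg (by omega), if_neg (by omega)]
      · rw [Sum.map_inr, h j hj]
      · have := h' j hj
        simp only [stdPoint, Sum.map_inr, Sum.elim_inr]
        rw [if_neg (by omega), if_neg (by omega)]
    · rintro (j | j) <;> simp [swapLast, hn]
  funext v
  have h := key (Sum.map σ σ v)
  rw [Sum.map_map] at h
  exact h

lemma eq_one_or_eq_swapLast (hn : 2 ≤ n) (ρ : Equiv.Perm (Fin n))
    (h : ∀ v : Fin n, ρ v = v ∨ (n - 2 ≤ (v : ℕ) ∧ n - 2 ≤ (ρ v : ℕ))) :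
    ρ = 1 ∨ ρ = swapLast n := by
  let p : Fin n := ⟨n - 2, by omega⟩
  let q : Fin n := ⟨n - 1, by omega⟩
  have hpq : ∀ v : Fin n, n - 2 ≤ (v : ℕ) → v = p ∨ v = q := by
    intro v hv
    have := v.2
    simp only [p, q, Fin.ext_iff]
    omega
  have hne : p ≠ q := by
    rw [Ne, Fin.ext_iff]
    simp only [p, q]
    omega
  have hρ : ∀ v : Fin n, v = p ∨ v = q → ρ v = p ∨ ρ v = q := by
    intro v hv
    rcases h v with h1 | h1
    · rwa [h1]
    · exact hpq _ h1.2
  have hinj := ρ.injective.ne hne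
  have hfix : ∀ v, v ≠ p → v ≠ q → ρ v = v := fun v h1 h2 =>
    (h v).resolve_right fun h3 => (hpq v h3.1).elim h1 h2
  rcases hρ p (Or.inl rfl) with hp | hp
  · left
    have hq : ρ q = q := (hρ q (Or.inr rfl)).resolve_left fun h' => hinj (hp.trans h'.symm)
    ext v
    by_cases h1 : v = p
    · rw [h1, hp]; rfl
    · by_cases h2 : v = q
      · rw [h2, hq]; rfl
      · rw [hfix v h1 h2]; rfl
  · right
    have hq : ρ q = p := (hρ q (Or.inr rfl)).resolve_right fun h' => hinj (hp.trans h'.symm)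
    have hs : swapLast n = Equiv.swap p q := dif_pos hn
    ext v
    by_cases h1 : v = p
    · rw [h1, hp, hs, Equiv.swap_apply_left]
    · by_cases h2 : v = q
      · rw [h2, hq, hs, Equiv.swap_apply_right]
      · rw [hfix v h1 h2, hs, Equiv.swap_apply_of_ne_of_ne h1 h2]

lemma range_evalReg_stdPoint_swap (hn : 2 ≤ n) {a : ℕ} (ha : a ≤ n - 2) :
    LinearMap.range (evalReg (stdPoint n a (n - 2))) = swapEigen n 1 := by
  refine le_antisymm ?_ fun g hg => mem_range_evalReg fun σ τ h => ?_
  · rintro _ ⟨f, rfl⟩ σ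
    rw [evalReg_apply, evalReg_apply, stdPoint_comp_swapLast a ha, one_mul]
  · rw [mem_swapEigen] at hg
    have h1 := stdPoint_comp_eq ha h
    rcases eq_one_or_eq_swapLast hn (σ * τ⁻¹) (fun v => by
      have := h1 (τ⁻¹ v)
      rw [← Equiv.Perm.mul_apply τ, mul_inv_cancel, Equiv.Perm.one_apply] at this
      exact this.imp_right And.symm) with h2 | h2
    · rw [mul_inv_eq_one.mp h2]
    · rw [mul_inv_eq_iff_eq_mul.mp h2, hg, one_mul]

end Evaluation

section Invariants

variable {n : ℕ}

variable (n) in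
/-- The ideal of polynomials whose class in the symmetric coinvariant algebra is zero. -/
def coinvIdeal : Ideal (XYPoly n) := (Jn n).comap (mkB n)

lemma mem_coinvIdeal {f : XYPoly n} : f ∈ coinvIdeal n ↔ mkB n f ∈ Jn n := Iff.rfl

lemma permB_mkB (σ : Equiv.Perm (Fin n)) (f : XYPoly n) :
    permB n σ (mkB n f) = mkB n (polyAct n σ f) := rfl

lemma ev0_mkB (f : XYPoly n) : ev0 n (mkB n f) = constantCoeff f := by
  change aeval (fun _ => (0 : ℂ)) f = _
  rw [← Pi.zero_def, aeval_zero]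
  rfl

lemma X_mul_X_mem_coinvIdeal (i : Fin n) : X (Sum.inl i) * X (Sum.inr i) ∈ coinvIdeal n := by
  rw [mem_coinvIdeal]
  have : mkB n (X (Sum.inl i) * X (Sum.inr i)) = 0 := by
    rw [Ideal.Quotient.mkₐ_eq_mk, Ideal.Quotient.eq_zero_iff_mem]
    exact Ideal.subset_span ⟨i, rfl⟩
  rw [this]
  exact Submodule.zero_mem _

lemma mem_coinvIdeal_of_invariant {f : XYPoly n} (hf : ∀ σ, polyAct n σ f = f)
    (h0 : constantCoeff f = 0) : f ∈ coinvIdeal n := by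
  rw [mem_coinvIdeal, Jn]
  refine Ideal.subset_span ⟨fun σ => ?_, ?_⟩
  · rw [permB_mkB, hf]
  · rw [ev0_mkB, h0]

lemma esymm_mem_coinvIdeal (c : Fin n → Fin n ⊕ Fin n)
    (hc : ∀ (σ : Equiv.Perm (Fin n)) t, Sum.map σ σ (c t) = c (σ t)) {k : ℕ} (hk : 1 ≤ k) :
    ∑ T ∈ Finset.powersetCard k Finset.univ, ∏ i ∈ T, (X (c i) : XYPoly n) ∈ coinvIdeal n := by
  refine mem_coinvIdeal_of_invariant (fun σ => ?_) ?_
  · simp only [map_sum, map_prod, rename_X, hc]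
    refine Finset.sum_bij (fun T _ => T.map σ.toEmbedding) ?_ ?_ ?_ ?_
    · intro T hT
      rw [Finset.mem_powersetCard_univ] at hT ⊢
      rw [Finset.card_map, hT]
    · intro T _ T' _ h
      exact Finset.map_injective _ h
    · intro T hT
      refine ⟨T.map σ.symm.toEmbedding, ?_, ?_⟩
      · rw [Finset.mem_powersetCard_univ] at hT ⊢
        rw [Finset.card_map, hT]
      · ext i
        simp
    · intro T _
      rw [Finset.prod_map]
      rfl
  · simp only [map_sum, map_prod, constantCoeff_X]
    refine Finset.sum_eq_zero fun T hT => ?_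
    rw [Finset.mem_powersetCard_univ] at hT
    obtain ⟨t, ht⟩ := Finset.card_pos.mp (show 0 < T.card by omega)
    exact Finset.prod_eq_zero ht rfl

lemma isStable_coinvIdeal : IsStable (coinvIdeal n) := by
  intro σ f hf
  rw [mem_coinvIdeal] at hf ⊢
  have h : Jn n ≤ (Jn n).comap (permB n σ) := by
    conv_lhs => rw [Jn]
    rw [Ideal.span_le]
    rintro p ⟨hp, h0⟩
    rw [SetLike.mem_coe, Ideal.mem_comap, hp]
    exact Ideal.subset_span ⟨hp, h0⟩
  exact h hf

lemma homComp_mem_leadingIdeal_of_invariant {p : Fin n ⊕ Fin n → ℂ} {f : XYPoly n}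
    (hf : ∀ σ, polyAct n σ f = f) (h0 : constantCoeff f = 0) (d : ℕ) :
    homComp n d f ∈ leadingIdeal (orbitIdeal p) := by
  cases d with
  | zero =>
    rw [homComp_apply, homogeneousComponent_zero, ← constantCoeff_eq, h0, C_0]
    exact Ideal.zero_mem _
  | succ d =>
    have h1 : homComp n (d + 1) f - C (eval p (homComp n (d + 1) f)) ∈ orbitIdeal p := by
      rw [mem_orbitIdeal]
      intro σ
      rw [map_sub, eval_C, sub_eq_zero]
      have h2 : homComp n (d + 1) f = polyAct n σ (homComp n (d + 1) f) := by
        rw [← single_smul_poly, ← map_smul, single_smul_poly, hf]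
      conv_rhs => rw [h2, eval_rename]
    have hC : ∀ e > 0, ∀ c : ℂ, homComp n e (C c) = 0 := by
      intro e he c
      exact homogeneousComponent_eq_zero _ _ (by rwa [totalDegree_C])
    have h3 := homComp_mem_leadingIdeal_of_mem (d := d + 1) h1 fun e he => by
      rw [map_sub, hC e (by omega), homComp_homComp, if_neg (by omega), sub_zero]
    rwa [map_sub, hC _ (by omega), homComp_homComp, if_pos rfl, sub_zero] at h3

lemma coinvIdeal_le_leadingIdeal {p : Fin n ⊕ Fin n → ℂ}
    (hp : ∀ j, p (Sum.inl j) * p (Sum.inr j) = 0) :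
    coinvIdeal n ≤ leadingIdeal (orbitIdeal p) := by
  have hB : Bideal n ≤ leadingIdeal (orbitIdeal p) := by
    rw [Ideal.span_le]
    rintro _ ⟨i, rfl⟩
    refine mem_leadingIdeal_of_isHomogeneous (d := 1 + 1) ?_
      ((isHomogeneous_X _ _).mul (isHomogeneous_X _ _))
    rw [mem_orbitIdeal]
    intro σ
    simp [hp]
  have hJ : Jn n ≤ (leadingIdeal (orbitIdeal p)).map (Ideal.Quotient.mk (Bideal n)) := by
    rw [Jn, Ideal.span_le]
    rintro s ⟨hs, h0⟩
    obtain ⟨f, rfl⟩ := Ideal.Quotient.mk_surjective s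
    change ∀ σ, permB n σ (mkB n f) = mkB n f at hs
    let f' : XYPoly n := (n.factorial : ℂ)⁻¹ • ∑ σ : Equiv.Perm (Fin n), polyAct n σ f
    have hf' : mkB n f' = mkB n f := by
      simp only [f', map_smul, map_sum, ← permB_mkB, hs]
      rw [Finset.sum_const, Finset.card_univ, Fintype.card_perm, Fintype.card_fin,
        ← Nat.cast_smul_eq_nsmul ℂ, smul_smul, inv_mul_cancel₀, one_smul]
      exact_mod_cast n.factorial_ne_zero
    have hinv : ∀ τ, polyAct n τ f' = f' := by
      intro τ
      simp only [f', map_smul, map_sum]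
      refine congrArg _ ?_
      refine Fintype.sum_equiv (Equiv.mulLeft τ) _ _ fun σ => ?_
      rw [rename_rename, Sum.map_comp_map]
      rfl
    have hc : constantCoeff f' = 0 := by
      rw [← ev0_mkB, hf']
      exact h0
    change mkB n f ∈ _
    rw [← hf']
    refine Ideal.mem_map_of_mem _ ?_
    rw [← sum_homogeneousComponent f']
    exact Ideal.sum_mem _ fun d _ => homComp_mem_leadingIdeal_of_invariant hinv hc d
  intro f hf
  have h := hJ hf
  rw [← Ideal.comap_map_mk hB]
  exact h

/-- The ideal generated by the squarefree monomials of degree `k` in one family of variables. -/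
def squarefreeIdeal (c : Fin n → Fin n ⊕ Fin n) (k : ℕ) : Ideal (XYPoly n) :=
  Ideal.span {f | ∃ T : Finset (Fin n), T.card = k ∧ f = ∏ t ∈ T, X (c t)}

lemma isStable_squarefreeIdeal (c : Fin n → Fin n ⊕ Fin n)
    (hc : ∀ (σ : Equiv.Perm (Fin n)) t, Sum.map σ σ (c t) = c (σ t)) (k : ℕ) :
    IsStable (squarefreeIdeal c k) := by
  intro σ f hf
  have h : squarefreeIdeal c k ≤ (squarefreeIdeal c k).comap (polyAct n σ) := by
    conv_lhs => rw [squarefreeIdeal]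
    rw [Ideal.span_le]
    rintro _ ⟨T, hT, rfl⟩
    rw [SetLike.mem_coe, Ideal.mem_comap]
    refine Ideal.subset_span ⟨T.map σ.toEmbedding, by rw [Finset.card_map, hT], ?_⟩
    simp only [map_prod, rename_X, hc, Finset.prod_map]
    rfl
  exact h hf

lemma squarefreeIdeal_le_leadingIdeal (c : Fin n → Fin n ⊕ Fin n)
    (hc : ∀ (σ : Equiv.Perm (Fin n)) t, Sum.map σ σ (c t) = c (σ t)) {k : ℕ}
    {p : Fin n ⊕ Fin n → ℂ} (S : Finset (Fin n)) (hS : ∀ j ∉ S, p (c j) = 0) (hk : S.card < k) :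
    squarefreeIdeal c k ≤ leadingIdeal (orbitIdeal p) := by
  rw [squarefreeIdeal, Ideal.span_le]
  rintro _ ⟨T, hT, rfl⟩
  refine mem_leadingIdeal_of_isHomogeneous (d := ∑ t ∈ T, 1) ?_
    (IsHomogeneous.prod T _ _ fun t _ => isHomogeneous_X _ _)
  rw [mem_orbitIdeal]
  intro σ
  obtain ⟨j, hj, hjS⟩ : ∃ j ∈ T.map σ.toEmbedding, j ∉ S := by
    by_contra! h
    have := Finset.card_le_card h
    rw [Finset.card_map] at this
    omega
  obtain ⟨t, ht, rfl⟩ := Finset.mem_map.mp hj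
  rw [map_prod]
  refine Finset.prod_eq_zero ht ?_
  rw [eval_X, Function.comp_apply, hc]
  exact hS _ hjS

lemma posCount_lt_of_zmon_notMem {L : Ideal (XYPoly n)} {k : ℕ} {c c' : Fin n → Fin n ⊕ Fin n}
    (hL : squarefreeIdeal c k ≤ L) {a : Fin n → ℤ}
    (ha : zmon (fun i => (X (c i) : XYPoly n)) (fun i => X (c' i)) a ∉ L) : posCount a < k := by
  by_contra! h
  obtain ⟨T, hT, hTk⟩ := Finset.exists_subset_card_eq h
  refine ha (Ideal.mem_of_dvd L ?_ (hL (Ideal.subset_span ⟨T, hTk, rfl⟩)))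
  refine dvd_trans (Finset.prod_dvd_prod_of_dvd _ _ fun t ht => ?_)
    (Finset.prod_dvd_prod_of_subset T Finset.univ _ (Finset.subset_univ _))
  have := (Finset.mem_filter.mp (hT ht)).2
  exact Dvd.dvd.mul_right (dvd_pow_self _ (by omega)) _

lemma finrank_quotient_squarefree_le (hn : 0 < n) (i : ℕ) (L : Ideal (XYPoly n))
    (hJ : coinvIdeal n ≤ L) (hK : squarefreeIdeal Sum.inl (i + 1) ≤ L) :
    Module.Finite ℂ (XYPoly n ⧸ L) ∧
      2 * Module.finrank ℂ (XYPoly n ⧸ L) ≤ 2 * n.factorial + i * n.factorial := by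
  obtain ⟨h1, h2⟩ := ncard_standard_posCount_le hn i
  obtain ⟨h3, h4⟩ := finrank_quotient_le_ncard L (fun i => hJ (X_mul_X_mem_coinvIdeal i))
    (fun k hk => hJ (esymm_mem_coinvIdeal Sum.inl (fun _ _ => rfl) hk))
    (fun k hk => hJ (esymm_mem_coinvIdeal Sum.inr (fun _ _ => rfl) hk)) _ h1
    (fun a ha haL => ⟨ha, posCount_lt_of_zmon_notMem hK haL⟩)
  exact ⟨h3, (Nat.mul_le_mul_left 2 h4).trans h2⟩

lemma finrank_quotient_squarefree_squarefree_le {i : ℕ} (hi : 1 ≤ i) (hin : i < n)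
    (L : Ideal (XYPoly n)) (hJ : coinvIdeal n ≤ L) (hK : squarefreeIdeal Sum.inl i ≤ L)
    (hK' : squarefreeIdeal Sum.inr (n - i) ≤ L) :
    Module.Finite ℂ (XYPoly n ⧸ L) ∧
      2 * Module.finrank ℂ (XYPoly n ⧸ L) ≤ n.factorial := by
  obtain ⟨h1, h2⟩ := ncard_standard_pos_neg hi hin
  obtain ⟨h3, h4⟩ := finrank_quotient_le_ncard L (fun i => hJ (X_mul_X_mem_coinvIdeal i))
    (fun k hk => hJ (esymm_mem_coinvIdeal Sum.inl (fun _ _ => rfl) hk))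
    (fun k hk => hJ (esymm_mem_coinvIdeal Sum.inr (fun _ _ => rfl) hk)) _ h1
    (fun a ha haL => ⟨ha, posCount_lt_of_zmon_notMem hK haL,
      posCount_lt_of_zmon_notMem (c' := Sum.inl) hK' (by rwa [zmon_neg])⟩)
  exact ⟨h3, (Nat.mul_le_mul_left 2 h4).trans h2⟩

lemma card_filter_val_lt_le (a b : ℕ) :
    (Finset.univ.filter fun j : Fin n => a ≤ (j : ℕ) ∧ (j : ℕ) < b).card ≤ b - a := by
  rw [← Nat.card_Ico]
  refine Finset.card_le_card_of_injOn (fun j => (j : ℕ)) ?_ (Fin.val_injective.injOn)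
  intro j hj
  simpa using hj

lemma squarefreeIdeal_inl_le (a b : ℕ) {k : ℕ} (hk : a < k) :
    squarefreeIdeal Sum.inl k ≤ leadingIdeal (orbitIdeal (stdPoint n a b)) := by
  refine squarefreeIdeal_le_leadingIdeal _ (fun _ _ => rfl)
    (Finset.univ.filter fun j : Fin n => 0 ≤ (j : ℕ) ∧ (j : ℕ) < a) ?_
    (lt_of_le_of_lt (card_filter_val_lt_le 0 a) hk)
  intro j hj
  simp only [Finset.mem_filter, Finset.mem_univ, zero_le, true_and] at hj
  simp only [stdPoint, Sum.elim_inl]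
  rw [if_neg hj]

lemma squarefreeIdeal_inr_le (a b : ℕ) {k : ℕ} (hk : b - a < k) :
    squarefreeIdeal Sum.inr k ≤ leadingIdeal (orbitIdeal (stdPoint n a b)) := by
  refine squarefreeIdeal_le_leadingIdeal _ (fun _ _ => rfl)
    (Finset.univ.filter fun j : Fin n => a ≤ (j : ℕ) ∧ (j : ℕ) < b) ?_
    (lt_of_le_of_lt (card_filter_val_lt_le a b) hk)
  intro j hj
  simp only [Finset.mem_filter, Finset.mem_univ, true_and] at hj
  simp only [stdPoint, Sum.elim_inr]
  rw [if_neg hj]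

end Invariants

section Structure

variable {n : ℕ}

lemma IsStable.sup {I K : Ideal (XYPoly n)} (hI : IsStable I) (hK : IsStable K) :
    IsStable (I ⊔ K) := by
  intro σ f hf
  obtain ⟨g, hg, h, hh, rfl⟩ := Submodule.mem_sup.mp hf
  rw [map_add]
  exact Submodule.add_mem_sup (hI σ g hg) (hK σ h hh)

/-- The quotient by a stable ideal, seen as an ideal or as a submodule over the group algebra. -/
def IsStable.quotientEquiv {I : Ideal (XYPoly n)} (hI : IsStable I) :
    (XYPoly n ⧸ hI.toSub) ≃ₗ[ℂ] (XYPoly n ⧸ I) :=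
  stableQuotientEquiv _ _ ≪≫ₗ Submodule.Quotient.restrictScalarsEquiv ℂ I

lemma eq_of_finrank_quotient_le {k A M : Type*} [Field k] [Ring A] [Algebra k A]
    [AddCommGroup M] [Module k M] [Module A M] [IsScalarTower k A M] {X Y : Submodule A M}
    (hXY : X ≤ Y) [Module.Finite k (M ⧸ X)]
    (h : Module.finrank k (M ⧸ X) ≤ Module.finrank k (M ⧸ Y)) : X = Y := by
  refine le_antisymm hXY fun f hf => ?_
  let φ : (M ⧸ X) →ₗ[k] (M ⧸ Y) := (Submodule.factor hXY).restrictScalars k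
  have hφ : Function.Surjective φ := Submodule.factor_surjective hXY
  have : Module.Finite k (M ⧸ Y) := Module.Finite.of_surjective φ hφ
  have heq : Module.finrank k (M ⧸ X) = Module.finrank k (M ⧸ Y) :=
    le_antisymm h (LinearMap.finrank_le_finrank_of_surjective hφ)
  have hinj := (LinearMap.injective_iff_surjective_of_finrank_eq_finrank heq).mpr hφ
  rw [← Submodule.Quotient.mk_eq_zero]
  refine hinj ?_
  rw [map_zero]
  change Submodule.Quotient.mk f = 0
  rwa [Submodule.Quotient.mk_eq_zero]

lemma finite_quotient_of_le {k A M : Type*} [Field k] [Ring A] [Algebra k A]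
    [AddCommGroup M] [Module k M] [Module A M] [IsScalarTower k A M] {U W : Submodule A M}
    (hUW : U ≤ W) [Module.Finite k (M ⧸ U)] : Module.Finite k (M ⧸ W) :=
  Module.Finite.of_surjective ((Submodule.factor hUW).restrictScalars k)
    (Submodule.factor_surjective hUW)

lemma finrank_quotient_le_of_le {k A M : Type*} [Field k] [Ring A] [Algebra k A]
    [AddCommGroup M] [Module k M] [Module A M] [IsScalarTower k A M] {U W : Submodule A M}
    (hUW : U ≤ W) [Module.Finite k (M ⧸ U)] :
    Module.finrank k (M ⧸ W) ≤ Module.finrank k (M ⧸ U) :=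
  LinearMap.finrank_le_finrank_of_surjective
    (f := (Submodule.factor hUW).restrictScalars k) (Submodule.factor_surjective hUW)

lemma nonempty_equiv_of_gluing {k A M S₁ S₂ S N : Type*} [Field k] [Ring A] [Algebra k A]
    [IsSemisimpleRing A]
    [AddCommGroup M] [Module k M] [Module A M] [IsScalarTower k A M]
    [AddCommGroup S₁] [Module A S₁] [AddCommGroup S₂] [Module A S₂]
    [AddCommGroup S] [Module A S] [AddCommGroup N] [Module A N] [IsArtinian A N]
    {Q X Y Z : Submodule A M} (e₁ : (M ⧸ X) ≃ₗ[A] S₁) (e₂ : (M ⧸ Y) ≃ₗ[A] S₂)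
    (e₃ : (M ⧸ Z) ≃ₗ[A] N) (e : (S₁ × S₂) ≃ₗ[A] (S × N)) (hQ : Q ≤ X ⊓ Y) (hZ : Z ≤ X ⊔ Y)
    [Module.Finite k (M ⧸ Q)] [Module.Finite k (M ⧸ Z)]
    (h : Module.finrank k (M ⧸ Q) + Module.finrank k (M ⧸ Z) ≤
      Module.finrank k (M ⧸ X) + Module.finrank k (M ⧸ Y)) :
    Nonempty ((M ⧸ Q) ≃ₗ[A] S) := by
  have := finite_quotient_of_le (k := k) hQ
  have := finite_quotient_of_le (k := k) hZ
  have := finite_quotient_of_le (k := k) (hQ.trans inf_le_left)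
  have := finite_quotient_of_le (k := k) (hQ.trans inf_le_right)
  obtain ⟨d⟩ := quotient_inf_prod_sup X Y
  have hd := (d.restrictScalars k).finrank_eq
  rw [Module.finrank_prod, Module.finrank_prod] at hd
  have h₁ := finrank_quotient_le_of_le (k := k) hQ
  have h₂ := finrank_quotient_le_of_le (k := k) hZ
  have hQ' : Q = X ⊓ Y := eq_of_finrank_quotient_le (k := k) hQ (by omega)
  have hZ' : Z = X ⊔ Y := eq_of_finrank_quotient_le (k := k) hZ (by omega)
  exact cancel_prod ((Submodule.quotEquivOfEq _ _ hQ').prodCongr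
    (e₃.symm ≪≫ₗ Submodule.quotEquivOfEq _ _ hZ') ≪≫ₗ d ≪≫ₗ e₁.prodCongr e₂ ≪≫ₗ e)

lemma squarefreeIdeal_succ_le (c : Fin n → Fin n ⊕ Fin n) (k : ℕ) :
    squarefreeIdeal c (k + 1) ≤ squarefreeIdeal c k := by
  conv_lhs => rw [squarefreeIdeal]
  refine Ideal.span_le.mpr ?_
  rintro _ ⟨T, hT, rfl⟩
  obtain ⟨t, ht⟩ : T.Nonempty := Finset.card_pos.mp (by omega)
  rw [SetLike.mem_coe, ← Finset.mul_prod_erase T (fun t => X (c t)) ht]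
  refine Ideal.mul_mem_left _ _ (Ideal.subset_span ⟨T.erase t, ?_, rfl⟩)
  rw [Finset.card_erase_of_mem ht, hT, Nat.add_sub_cancel]

lemma isStable_coinvIdeal_sup (k : ℕ) :
    IsStable (coinvIdeal n ⊔ squarefreeIdeal Sum.inl k) :=
  isStable_coinvIdeal.sup (isStable_squarefreeIdeal _ (fun _ _ => rfl) k)

instance : NeZero ((Nat.card (Equiv.Perm (Fin n)) : ℕ) : ℂ) :=
  ⟨by exact_mod_cast Nat.card_pos.ne'⟩

instance : IsSemisimpleRing (GrpAlg n) :=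
  inferInstanceAs (IsSemisimpleModule (GrpAlg n) (GrpAlg n))

lemma nonempty_reg_equiv_prod :
    Nonempty (Reg n ≃ₗ[GrpAlg n] (swapEigen n (-1) × swapEigen n 1)) :=
  ⟨(Submodule.prodEquivOfIsCompl _ _ isCompl_swapEigen.symm).symm⟩

variable (n) in
/-- The expected quotients in the filtration of the coinvariant algebra. -/
abbrev StageModule (i : ℕ) : Type := Reg n × (Fin i → swapEigen n (-1))

lemma two_mul_finrank_stageModule (hn : 2 ≤ n) (i : ℕ) :
    2 * Module.finrank ℂ (StageModule n i) = 2 * n.factorial + i * n.factorial := by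
  rw [Module.finrank_prod, Module.finrank_pi_fintype, finrank_reg]
  simp only [Finset.sum_const, Finset.card_univ, Fintype.card_fin, smul_eq_mul]
  have := (two_mul_finrank_swapEigen hn).2
  rw [mul_add, mul_left_comm, this]

lemma nonempty_stageModule_succ (i : ℕ) :
    Nonempty ((StageModule n i × Reg n) ≃ₗ[GrpAlg n] (StageModule n (i + 1) × swapEigen n 1)) := by
  obtain ⟨e⟩ := nonempty_reg_equiv_prod (n := n)
  refine ⟨LinearEquiv.ofBijective
    { toFun := fun p => ((p.1.1, Fin.cons (e p.2).1 p.1.2), (e p.2).2)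
      map_add' := fun p q => ?_
      map_smul' := fun a p => ?_ } ⟨fun p q h => ?_, fun p => ?_⟩⟩
  · refine Prod.ext (Prod.ext rfl (funext fun t => ?_)) ?_
    · refine Fin.cases ?_ (fun t => ?_) t <;> simp
    · simp
  · refine Prod.ext (Prod.ext rfl (funext fun t => ?_)) ?_
    · refine Fin.cases ?_ (fun t => ?_) t <;> simp
    · simp
  · obtain ⟨⟨h₁, h₂⟩, h₃⟩ := by simpa [Prod.ext_iff, Fin.cons_inj] using h
    exact Prod.ext (Prod.ext h₁ h₂.2) (e.injective (Prod.ext h₂.1 h₃))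
  · refine ⟨((p.1.1, Fin.tail p.1.2), e.symm (p.1.2 0, p.2)), ?_⟩
    simp

lemma leading_le_sup (hn : 2 ≤ n) {i : ℕ} (hi : i + 1 ≤ n - 1)
    (h : 2 * Module.finrank ℂ
      (XYPoly n ⧸ (isStable_orbitIdeal (stdPoint n i (n - 2))).leading.toSub) = n.factorial) :
    (isStable_orbitIdeal (stdPoint n i (n - 2))).leading.toSub ≤
      (isStable_coinvIdeal_sup (n := n) (i + 1)).toSub ⊔
        (isStable_orbitIdeal (stdPoint n (i + 1) (n - 1))).leading.toSub := by
  have hL : IsStable (coinvIdeal n ⊔ squarefreeIdeal Sum.inl (i + 1) ⊔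
      squarefreeIdeal Sum.inr (n - (i + 1))) :=
    (isStable_coinvIdeal_sup (i + 1)).sup (isStable_squarefreeIdeal _ (fun _ _ => rfl) _)
  have hle : hL.toSub ≤ (isStable_orbitIdeal (stdPoint n i (n - 2))).leading.toSub :=
    sup_le (sup_le (coinvIdeal_le_leadingIdeal (stdPoint_mul _ _))
      (squarefreeIdeal_inl_le _ _ (by omega))) (squarefreeIdeal_inr_le _ _ (by omega))
  obtain ⟨h₁, h₂⟩ := finrank_quotient_squarefree_squarefree_le (n := n) (i := i + 1) (by omega)
    (by omega) _ (le_sup_left.trans le_sup_left) (le_sup_right.trans le_sup_left) le_sup_right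
  have : Module.Finite ℂ (XYPoly n ⧸ hL.toSub) := Module.Finite.equiv hL.quotientEquiv.symm
  rw [← hL.quotientEquiv.finrank_eq, ← h] at h₂
  rw [← eq_of_finrank_quotient_le (k := ℂ) hle (by omega)]
  intro f hf
  obtain ⟨g, hg, g', hg', rfl⟩ := Submodule.mem_sup.mp (hL.mem_toSub.mp hf)
  exact Submodule.add_mem_sup hg (squarefreeIdeal_inr_le _ _ (by omega) hg')

lemma nonempty_quotient_equiv_stageModule (hn : 2 ≤ n) (i : ℕ) (hi : i ≤ n - 1) :
    Nonempty ((XYPoly n ⧸ (isStable_coinvIdeal_sup (n := n) (i + 1)).toSub) ≃ₗ[GrpAlg n]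
      StageModule n i) := by
  have htop : ∀ i ≤ n - 1, Nonempty ((XYPoly n ⧸
      (isStable_orbitIdeal (stdPoint n i (n - 1))).leading.toSub) ≃ₗ[GrpAlg n] Reg n) := by
    intro i hi
    obtain ⟨e⟩ := nonempty_quotient_leadingIdeal_equiv _ ⊤ (range_evalReg_stdPoint_top hi)
    exact ⟨e ≪≫ₗ Submodule.topEquiv⟩
  have hle : ∀ i, (isStable_coinvIdeal_sup (n := n) (i + 1)).toSub ≤
      (isStable_orbitIdeal (stdPoint n i (n - 1))).leading.toSub := fun i =>
    sup_le (coinvIdeal_le_leadingIdeal (stdPoint_mul _ _)) (squarefreeIdeal_inl_le _ _ (by omega))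
  have hfin : ∀ i, Module.Finite ℂ (XYPoly n ⧸ (isStable_coinvIdeal_sup (n := n) (i + 1)).toSub) ∧
      2 * Module.finrank ℂ (XYPoly n ⧸ (isStable_coinvIdeal_sup (n := n) (i + 1)).toSub) ≤
        2 * n.factorial + i * n.factorial := by
    intro i
    obtain ⟨h1, h2⟩ := finrank_quotient_squarefree_le (by omega) i
      (coinvIdeal n ⊔ squarefreeIdeal Sum.inl (i + 1)) le_sup_left le_sup_right
    have e := (isStable_coinvIdeal_sup (n := n) (i + 1)).quotientEquiv
    exact ⟨Module.Finite.equiv e.symm, by rwa [e.finrank_eq]⟩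
  induction i with
  | zero =>
    obtain ⟨e⟩ := htop 0 (Nat.zero_le _)
    have h1 := (hfin 0).1
    have h2 := (e.restrictScalars ℂ).finrank_eq
    rw [finrank_reg] at h2
    have h3 := eq_of_finrank_quotient_le (k := ℂ) (hle 0) (by have := (hfin 0).2; omega)
    exact ⟨Submodule.quotEquivOfEq _ _ h3 ≪≫ₗ e ≪≫ₗ LinearEquiv.prodUnique.symm⟩
  | succ i ih =>
    obtain ⟨eX⟩ := ih (by omega)
    obtain ⟨eY⟩ := htop (i + 1) hi
    obtain ⟨eZ⟩ := nonempty_quotient_leadingIdeal_equiv _ _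
      (range_evalReg_stdPoint_swap hn (a := i) (by omega))
    have dX := (eX.restrictScalars ℂ).finrank_eq
    have dX' := two_mul_finrank_stageModule hn i
    have dY := (eY.restrictScalars ℂ).finrank_eq
    rw [finrank_reg] at dY
    have dZ := (eZ.restrictScalars ℂ).finrank_eq
    have dZ' := (two_mul_finrank_swapEigen hn).1
    have hQ := hfin (i + 1)
    have hQ₁ := hQ.1
    have hmul : (i + 1) * n.factorial = i * n.factorial + n.factorial := by ring
    obtain ⟨e⟩ := nonempty_stageModule_succ (n := n) i
    have : IsArtinian (GrpAlg n) (swapEigen n 1) := isArtinian_of_tower ℂ inferInstance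
    have : Module.Finite ℂ (XYPoly n ⧸ (isStable_orbitIdeal (stdPoint n i (n - 2))).leading.toSub) :=
      Module.Finite.equiv (eZ.restrictScalars ℂ).symm
    refine nonempty_equiv_of_gluing (k := ℂ) eX eY eZ e
      (le_inf (sup_le_sup_left (squarefreeIdeal_succ_le _ _) (coinvIdeal n)) (hle (i + 1))) ?_
      (by omega)
    exact leading_le_sup hn hi (by rw [dZ, dZ'])

end Structure

section Assembly

variable {n : ℕ}

lemma squarefreeIdeal_self_le (hn : 2 ≤ n) : squarefreeIdeal Sum.inl n ≤ coinvIdeal n := by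
  conv_lhs => rw [squarefreeIdeal]
  refine Ideal.span_le.mpr ?_
  rintro _ ⟨T, hT, rfl⟩
  obtain rfl : T = Finset.univ := by
    rw [← Finset.card_eq_iff_eq_univ, hT, Fintype.card_fin]
  have h := esymm_mem_coinvIdeal (n := n) (k := n) Sum.inl (fun _ _ => rfl) (by omega)
  have hs : Finset.powersetCard n (Finset.univ : Finset (Fin n)) = {Finset.univ} := by
    have := Finset.powersetCard_self (Finset.univ : Finset (Fin n))
    rwa [hT] at this
  rwa [hs, Finset.sum_singleton] at h

lemma nonempty_quotient_coinvIdeal_equiv (hn : 2 ≤ n) :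
    Nonempty ((XYPoly n ⧸ (isStable_coinvIdeal (n := n)).toSub) ≃ₗ[GrpAlg n]
      StageModule n (n - 1)) := by
  obtain ⟨e⟩ := nonempty_quotient_equiv_stageModule hn (n - 1) le_rfl
  refine ⟨Submodule.quotEquivOfEq _ _ ?_ ≪≫ₗ e⟩
  refine le_antisymm (fun f hf => ?_) (fun f hf => ?_)
  · exact (le_sup_left : coinvIdeal n ≤ _) hf
  · refine (sup_le le_rfl ?_ : coinvIdeal n ⊔ squarefreeIdeal Sum.inl (n - 1 + 1) ≤ coinvIdeal n) hf
    rw [Nat.sub_add_cancel (by omega)]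
    exact squarefreeIdeal_self_le hn

variable (n) in
/-- The projection of the polynomial ring onto the coinvariant algebra. -/
def toRn : XYPoly n →ₗ[ℂ] Rn n :=
  (Ideal.Quotient.mkₐ ℂ (Jn n)).toLinearMap ∘ₗ (mkB n).toLinearMap

lemma toRn_surjective : Function.Surjective (toRn n) :=
  (Ideal.Quotient.mk_surjective (I := Jn n)).comp (Ideal.Quotient.mk_surjective (I := Bideal n))

lemma permR_toRn (σ : Equiv.Perm (Fin n)) (f : XYPoly n) :
    permR n σ (toRn n f) = toRn n (polyAct n σ f) := rfl

lemma ker_toRn : LinearMap.ker (toRn n) = (coinvIdeal n).restrictScalars ℂ := by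
  ext f
  exact Ideal.Quotient.eq_zero_iff_mem

/-- The coinvariant algebra, as a representation of the symmetric group, is the sum of the
regular representation and `n - 1` copies of the representation induced from the sign of the
last transposition. -/
lemma exists_rn_equiv (hn : 2 ≤ n) :
    ∃ Θ : Rn n ≃ₗ[ℂ] StageModule n (n - 1), ∀ (σ : Equiv.Perm (Fin n)) (x : Rn n),
      Θ (permR n σ x) = (MonoidAlgebra.single σ 1 : GrpAlg n) • Θ x := by
  obtain ⟨θ⟩ := nonempty_quotient_coinvIdeal_equiv hn
  let ψ : (XYPoly n ⧸ (isStable_coinvIdeal (n := n)).toSub) ≃ₗ[ℂ] Rn n :=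
    stableQuotientEquiv _ _ ≪≫ₗ Submodule.quotEquivOfEq _ _ ker_toRn.symm ≪≫ₗ
      (toRn n).quotKerEquivOfSurjective toRn_surjective
  have hψ (f : XYPoly n) : ψ (Submodule.Quotient.mk f) = toRn n f := rfl
  refine ⟨ψ.symm ≪≫ₗ θ.restrictScalars ℂ, fun σ x => ?_⟩
  obtain ⟨f, rfl⟩ := toRn_surjective x
  rw [permR_toRn, ← hψ, ← hψ]
  simp only [LinearEquiv.trans_apply, LinearEquiv.symm_apply_apply,
    LinearEquiv.restrictScalars_apply]
  rw [← θ.map_smul, ← Submodule.Quotient.mk_smul, single_smul_poly]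

lemma slAct_comp {r n : ℕ} {M N : Type} [AddCommGroup M] [Module ℂ M] [AddCommGroup N]
    [Module ℂ N] (L : M →ₗ[ℂ] N) (X : Matrix (Fin (r + 1)) (Fin (r + 1)) ℂ)
    (F : (Fin n → Fin (r + 1)) → M) (φ : Fin n → Fin (r + 1)) :
    slAct r n N X (fun ψ => L (F ψ)) φ = L (slAct r n M X F φ) := by
  simp only [slAct, LinearMap.coe_mk, AddHom.coe_mk, map_sum, map_smul]

lemma slAct_apply_comp_perm {r n : ℕ} {M : Type} [AddCommGroup M] [Module ℂ M]
    (X : Matrix (Fin (r + 1)) (Fin (r + 1)) ℂ) (F : (Fin n → Fin (r + 1)) → M)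
    (σ : Equiv.Perm (Fin n)) (φ : Fin n → Fin (r + 1)) :
    slAct r n M X F (φ ∘ σ) = slAct r n M X (fun ψ => F (ψ ∘ σ)) φ := by
  simp only [slAct, LinearMap.coe_mk, AddHom.coe_mk]
  refine Fintype.sum_equiv σ _ _ fun k => Finset.sum_congr rfl fun j _ => ?_
  have h : Function.update (φ ∘ σ) k j = Function.update φ (σ k) j ∘ σ := by
    rw [Function.update_comp_eq_of_injective φ σ.injective]
  rw [h, Function.comp_apply]

lemma slAct_mem_InvSub {r n : ℕ} (X : Matrix (Fin (r + 1)) (Fin (r + 1)) ℂ)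
    {F : (Fin n → Fin (r + 1)) → Rn n} (hF : F ∈ InvSub r n) :
    slAct r n (Rn n) X F ∈ InvSub r n := by
  intro σ φ
  rw [slAct_apply_comp_perm]
  refine (slAct_comp (permR n σ).toLinearMap X _ φ).symm.trans ?_
  exact congrArg (fun G => slAct r n (Rn n) X G φ) (funext fun ψ => hF σ ψ)

lemma slAct_mem_AltLast {r n : ℕ} (X : Matrix (Fin (r + 1)) (Fin (r + 1)) ℂ)
    {F : (Fin n → Fin (r + 1)) → ℂ} (hF : F ∈ AltLast r n) :
    slAct r n ℂ X F ∈ AltLast r n := by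
  intro φ
  rw [slAct_apply_comp_perm, ← Pi.neg_apply, ← map_neg]
  exact congrArg (fun G => slAct r n ℂ X G φ) (funext fun ψ => hF ψ)

lemma fst_comp_perm {r : ℕ} {Θ : Rn n ≃ₗ[ℂ] StageModule n (n - 1)}
    (hΘ : ∀ (σ : Equiv.Perm (Fin n)) (x : Rn n),
      Θ (permR n σ x) = (MonoidAlgebra.single σ 1 : GrpAlg n) • Θ x)
    {F : (Fin n → Fin (r + 1)) → Rn n} (hF : F ∈ InvSub r n)
    (σ τ : Equiv.Perm (Fin n)) (φ : Fin n → Fin (r + 1)) :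
    (Θ (F φ)).1 τ = (Θ (F (φ ∘ σ))).1 (τ * σ) := by
  rw [← hF σ φ, hΘ, Prod.smul_fst, single_smul_reg]

lemma snd_comp_perm {r : ℕ} {Θ : Rn n ≃ₗ[ℂ] StageModule n (n - 1)}
    (hΘ : ∀ (σ : Equiv.Perm (Fin n)) (x : Rn n),
      Θ (permR n σ x) = (MonoidAlgebra.single σ 1 : GrpAlg n) • Θ x)
    {F : (Fin n → Fin (r + 1)) → Rn n} (hF : F ∈ InvSub r n)
    (σ τ : Equiv.Perm (Fin n)) (φ : Fin n → Fin (r + 1)) (t : Fin (n - 1)) :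
    ((Θ (F φ)).2 t).1 τ = ((Θ (F (φ ∘ σ))).2 t).1 (τ * σ) := by
  rw [← hF σ φ, hΘ, Prod.smul_snd, Pi.smul_apply, Submodule.coe_smul, single_smul_reg]

/-- The value at the identity of the component in the regular representation. -/
def fstCoord (Θ : Rn n ≃ₗ[ℂ] StageModule n (n - 1)) : Rn n →ₗ[ℂ] ℂ where
  toFun x := (Θ x).1 1
  map_add' x y := by rw [map_add]; rfl
  map_smul' c x := by rw [map_smul]; rfl

/-- The value at the identity of a component in an induced sign representation. -/
def sndCoord (Θ : Rn n ≃ₗ[ℂ] StageModule n (n - 1)) (t : Fin (n - 1)) : Rn n →ₗ[ℂ] ℂ where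
  toFun x := ((Θ x).2 t).1 1
  map_add' x y := by rw [map_add]; rfl
  map_smul' c x := by rw [map_smul]; rfl

lemma sndCoord_mem_AltLast {r : ℕ} {Θ : Rn n ≃ₗ[ℂ] StageModule n (n - 1)}
    (hΘ : ∀ (σ : Equiv.Perm (Fin n)) (x : Rn n),
      Θ (permR n σ x) = (MonoidAlgebra.single σ 1 : GrpAlg n) • Θ x)
    {F : (Fin n → Fin (r + 1)) → Rn n} (hF : F ∈ InvSub r n) (t : Fin (n - 1)) :
    (fun φ => sndCoord Θ t (F φ)) ∈ AltLast r n := by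
  intro φ
  have h₁ := snd_comp_perm hΘ hF (swapLast n) (swapLast n) φ t
  have h₂ := ((Θ (F φ)).2 t).2 1
  rw [swapLast_mul_self] at h₁
  rw [mul_one, neg_one_mul] at h₂
  exact h₁.symm.trans h₂

/-- The coordinates of an invariant tensor. -/
def invSubCoord {r : ℕ} (Θ : Rn n ≃ₗ[ℂ] StageModule n (n - 1))
    (hΘ : ∀ (σ : Equiv.Perm (Fin n)) (x : Rn n),
      Θ (permR n σ x) = (MonoidAlgebra.single σ 1 : GrpAlg n) • Θ x) :
    InvSub r n →ₗ[ℂ] ((Fin n → Fin (r + 1)) → ℂ) × (Fin (n - 1) → AltLast r n) where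
  toFun F := (fun φ => fstCoord Θ (F.1 φ),
    fun t => ⟨fun φ => sndCoord Θ t (F.1 φ), sndCoord_mem_AltLast hΘ F.2 t⟩)
  map_add' _ _ := Prod.ext (funext fun _ => map_add (fstCoord Θ) _ _)
    (funext fun t => Subtype.ext (funext fun _ => map_add (sndCoord Θ t) _ _))
  map_smul' _ _ := Prod.ext (funext fun _ => map_smul (fstCoord Θ) _ _)
    (funext fun t => Subtype.ext (funext fun _ => map_smul (sndCoord Θ t) _ _))

lemma invSubCoord_bijective {r : ℕ} (Θ : Rn n ≃ₗ[ℂ] StageModule n (n - 1))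
    (hΘ : ∀ (σ : Equiv.Perm (Fin n)) (x : Rn n),
      Θ (permR n σ x) = (MonoidAlgebra.single σ 1 : GrpAlg n) • Θ x) :
    Function.Bijective (invSubCoord (r := r) Θ hΘ) := by
  constructor
  · rw [injective_iff_map_eq_zero]
    intro F hF
    refine Subtype.ext (funext fun φ => Θ.injective ?_)
    refine (Prod.ext (funext fun τ => ?_) (funext fun t => Subtype.ext (funext fun τ => ?_)) :
      Θ (F.1 φ) = 0).trans (map_zero Θ).symm
    · refine (fst_comp_perm hΘ F.2 τ⁻¹ τ φ).trans ?_
      rw [mul_inv_cancel]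
      exact congrFun (congrArg Prod.fst hF) (φ ∘ ⇑τ⁻¹)
    · refine (snd_comp_perm hΘ F.2 τ⁻¹ τ φ t).trans ?_
      rw [mul_inv_cancel]
      exact congrFun (congrArg Subtype.val (congrFun (congrArg Prod.snd hF) t)) (φ ∘ ⇑τ⁻¹)
  · rintro ⟨u, w⟩
    have hw (t : Fin (n - 1)) (φ : Fin n → Fin (r + 1)) :
        (fun σ => (w t).1 (φ ∘ ⇑σ⁻¹) : Reg n) ∈ swapEigen n (-1) := by
      intro σ
      have hs : (swapLast n)⁻¹ = swapLast n := inv_eq_of_mul_eq_one_left swapLast_mul_self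
      have := (w t).2 (φ ∘ ⇑σ⁻¹)
      rw [neg_one_mul]
      refine Eq.trans ?_ this
      beta_reduce
      rw [mul_inv_rev, hs]
      rfl
    let F : (Fin n → Fin (r + 1)) → Rn n := fun φ =>
      Θ.symm (fun σ : Equiv.Perm (Fin n) => u (φ ∘ ⇑σ⁻¹), fun t => ⟨fun σ => (w t).1 (φ ∘ ⇑σ⁻¹), hw t φ⟩)
    have hΘF (φ : Fin n → Fin (r + 1)) : Θ (F φ) =
        (fun σ : Equiv.Perm (Fin n) => u (φ ∘ ⇑σ⁻¹), fun t => ⟨fun σ => (w t).1 (φ ∘ ⇑σ⁻¹), hw t φ⟩) :=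
      Θ.apply_symm_apply _
    have hcomp (φ : Fin n → Fin (r + 1)) (σ τ : Equiv.Perm (Fin n)) :
        (φ ∘ σ) ∘ ⇑(τ * σ)⁻¹ = φ ∘ ⇑τ⁻¹ := by
      rw [Function.comp_assoc, ← Equiv.Perm.coe_mul, mul_inv_rev, mul_inv_cancel_left]
    have hF : F ∈ InvSub r n := by
      intro σ φ
      refine Θ.injective ?_
      rw [hΘ, hΘF, hΘF]
      refine Prod.ext (funext fun τ => ?_) (funext fun t => Subtype.ext (funext fun τ => ?_))
      · exact (single_smul_reg σ _ τ).trans (congrArg u (hcomp φ σ τ))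
      · exact (single_smul_reg σ _ τ).trans (congrArg (w t).1 (hcomp φ σ τ))
    refine ⟨⟨F, hF⟩, Prod.ext (funext fun φ => ?_)
      (funext fun t => Subtype.ext (funext fun φ => ?_))⟩
    · exact congrFun (congrArg Prod.fst (hΘF φ)) 1
    · exact congrFun (congrArg Subtype.val (congrFun (congrArg Prod.snd (hΘF φ)) t)) 1

end Assembly

/-- For `r ≥ 1`, `n ≥ 2`, the space of `Sₙ`-invariants
`(V^{⊗n} ⊗ Rₙ)^{Sₙ}` is isomorphic as an `sl_{r+1}(ℂ)`-module to
`V^{⊗n} ⊕ (n−1)·(V^{⊗(n−2)} ⊗ ∧²V)`, where `V = ℂ^{r+1}` is the vector representation.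
Here `V^{⊗n}` is realized as `(Fin n → Fin (r+1)) → ℂ` (functions on the index set of
the standard basis), `V^{⊗(n−2)} ⊗ ∧²V` as the subspace `AltLast` of `V^{⊗n}` of tensors
antisymmetric in the last two factors, the `sl_{r+1}`-action is `slAct`, and the
isomorphism is an `sl_{r+1}`-equivariant `ℂ`-linear equivalence (the first two
conjuncts state that both sides are `sl_{r+1}`-stable). -/
theorem weyl_module_structure (r n : ℕ) (hr : 1 ≤ r) (hn : 2 ≤ n) :
    (∀ X : LieAlgebra.SpecialLinear.sl (Fin (r + 1)) ℂ, ∀ F ∈ InvSub r n,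
      slAct r n (Rn n) (↑X : Matrix (Fin (r + 1)) (Fin (r + 1)) ℂ) F ∈ InvSub r n) ∧
    (∀ X : LieAlgebra.SpecialLinear.sl (Fin (r + 1)) ℂ, ∀ G ∈ AltLast r n,
      slAct r n ℂ (↑X : Matrix (Fin (r + 1)) (Fin (r + 1)) ℂ) G ∈ AltLast r n) ∧
    ∃ e : ↥(InvSub r n) ≃ₗ[ℂ]
        (((Fin n → Fin (r + 1)) → ℂ) × (Fin (n - 1) → ↥(AltLast r n))),
      ∀ (X : LieAlgebra.SpecialLinear.sl (Fin (r + 1)) ℂ) (F G : ↥(InvSub r n)),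
        slAct r n (Rn n) (↑X : Matrix (Fin (r + 1)) (Fin (r + 1)) ℂ) (↑F) = (↑G : (Fin n → Fin (r + 1)) → Rn n) →
          slAct r n ℂ (↑X : Matrix (Fin (r + 1)) (Fin (r + 1)) ℂ) (e F).1 = (e G).1 ∧
          ∀ t : Fin (n - 1),
            slAct r n ℂ (↑X : Matrix (Fin (r + 1)) (Fin (r + 1)) ℂ) (↑((e F).2 t)) =
              (↑((e G).2 t) : (Fin n → Fin (r + 1)) → ℂ) := by
  obtain ⟨Θ, hΘ⟩ := exists_rn_equiv hn
  refine ⟨fun X F hF => slAct_mem_InvSub _ hF, fun X G hG => slAct_mem_AltLast _ hG,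
    LinearEquiv.ofBijective _ (invSubCoord_bijective Θ hΘ), fun X F G h => ⟨?_, fun t => ?_⟩⟩
  · funext φ
    exact (slAct_comp (fstCoord Θ) _ F.1 φ).trans (congrArg (fun H => fstCoord Θ (H φ)) h)
  · funext φ
    exact (slAct_comp (sndCoord Θ t) _ F.1 φ).trans (congrArg (fun H => sndCoord Θ t (H φ)) h)

end
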